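/- arXiv:0909.5669 — 6 statements merged into one kernel-verified Lean document; each statement's English description precedes it below -/
import Mathlib

section
/- Let 𝐼 = (𝒫, ℒ) be a cyclic symmetric (v,k)-configuration, d a divisor of v, t = v/d, with point orbits O_0,…,O_{t−1} and block orbits L_0,…,L_{t−1} of the subgroup generated by σ^t, indexed as described, and w_u = |ℓ_0 ∩ O_u|. Then for all i, j ∈ {0,…,t−1}, through every point of the orbit O_j there pass exactly w_{(j−i) mod t} blocks of the orbit L_i. -/
/-- Let `(𝒫, ℒ)` be a cyclic symmetric `(v,k)`-configuration: we identify the points with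
`ZMod v` via the regular action of the cyclic automorphism `σ : x ↦ x + 1`, so that the
blocks are `ℓ 0, ℓ 1, …, ℓ (v-1)` with `ℓ i = σ^i (ℓ 0)`, i.e. `x ∈ ℓ i ↔ x - i ∈ ℓ 0`.
Configuration axioms: every block has `k` points, every point lies in `k` blocks, two
distinct points lie in at most one common block; the blocks are pairwise distinct
(σ acts regularly on the blocks).  For a divisor `d` of `v` put `t = v / d`; the point
orbits of the subgroup generated by `σ^t` are `O u = {x | x ≡ u (mod t)}` (`u : ZMod t`)
and the block orbits are `L i = {ℓ a | a ≡ i (mod t)}`, indexed so that `0 ∈ O 0` and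
`ℓ 0 ∈ L 0`.  With `w u = |ℓ 0 ∩ O u|`, through every point of the orbit `O j` there pass
exactly `w (j - i)` blocks of the orbit `L i`. -/
theorem stmt2 (v k d t : ℕ) (hv : 0 < v) (hd : 0 < d) (hdt : v = d * t)
    (hdvd : t ∣ v)
    (ℓ : ZMod v → Set (ZMod v))
    (hshift : ∀ (i x : ZMod v), x ∈ ℓ i ↔ x - i ∈ ℓ 0)
    (hblocksize : ∀ i : ZMod v, (ℓ i).ncard = k)
    (hpointdeg : ∀ x : ZMod v, {i : ZMod v | x ∈ ℓ i}.ncard = k)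
    (hlin : ∀ x y : ZMod v, x ≠ y → {i : ZMod v | x ∈ ℓ i ∧ y ∈ ℓ i}.Subsingleton)
    (hreg : Function.Injective ℓ)
    (O : ZMod t → Set (ZMod v))
    (hO : ∀ u : ZMod t, O u = {x : ZMod v | ZMod.castHom hdvd (ZMod t) x = u})
    (w : ZMod t → ℕ)
    (hw : ∀ u : ZMod t, w u = (ℓ 0 ∩ O u).ncard) :
    ∀ (i j : ZMod t), ∀ x ∈ O j,
      {a : ZMod v | ZMod.castHom hdvd (ZMod t) a = i ∧ x ∈ ℓ a}.ncard = w (j - i) := by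
  intro i j x hx
  rw [hO] at hx
  rw [hw, hO, ← Set.ncard_image_of_injective _ (sub_right_injective (b := x))]
  congr 1
  ext y
  simp only [Set.mem_image, Set.mem_inter_iff, Set.mem_ofPred_eq] at hx ⊢
  constructor
  · rintro ⟨a, ⟨rfl, hxa⟩, rfl⟩
    exact ⟨(hshift a x).1 hxa, by rw [map_sub, hx]⟩
  · rintro ⟨hy, hyu⟩
    refine ⟨x - y, ⟨by rw [map_sub, hx, hyu, sub_sub_cancel], ?_⟩, sub_sub_cancel x y⟩
    rwa [hshift, sub_sub_cancel]
end

section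
/- In the Singer model of PG(2,q) with q = p^h (p prime), v = q²+q+1, d a divisor of v, t = v/d, with point orbits O_0,…,O_{t−1} of the subgroup generated by σ^t indexed as described, suppose the line ℓ_0 is left invariant by the collineation τ : P_i ↦ P_{(ip) mod v}, and set w_u = |ℓ_0 ∩ O_u|. Then w_u = w_{(pu) mod t} for every u ∈ {0,…,t−1}, and consequently the number of distinct values among w_0, w_1, …, w_{t−1} is at most s(p,t) + 1, where s(p,t) is the number of orbits of Z_t ∖ {0} under the permutation group generated by the map i ↦ p·i (mod t). -/
/-- `sOrb p t` is the number of orbits of `(ZMod t) \\ {0}` under the permutation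
group generated by the map `i ↦ p * i (mod t)` (for `p` coprime to `t` the forward
orbit `{p^n * x}` of `x` is its full orbit). -/
noncomputable def sOrb (p t : ℕ) : ℕ :=
  {S : Set (ZMod t) | ∃ x : ZMod t, x ≠ 0 ∧
    S = {y : ZMod t | ∃ n : ℕ, y = (p : ZMod t) ^ n * x}}.ncard

/-- In a finite field, a subfield `K` contains every solution of `x ^ (|K| - 1) = 1`. -/
theorem Subfield.mem_of_pow_natCard_sub_one {F : Type*} [Field F] [Finite F] (K : Subfield F)
    {x : F} (hx : x ≠ 0) (h : x ^ (Nat.card K - 1) = 1) : x ∈ K := by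
  classical
  have := Fintype.ofFinite F
  have hcu : Fintype.card Kˣ = Nat.card K - 1 := by
    rw [← Nat.card_eq_fintype_card, Nat.card_units]
  have hpos : 0 < Nat.card K - 1 := hcu ▸ Fintype.card_pos
  let A : Finset Fˣ := Finset.univ.filter fun a => a ^ (Nat.card K - 1) = 1
  let B : Finset Fˣ := Finset.univ.image (Units.map K.subtype.toMonoidHom)
  have hinj : Function.Injective (Units.map K.subtype.toMonoidHom) :=
    Units.map_injective K.subtype.injective
  have hBA : B ⊆ A := by
    intro b hb
    obtain ⟨c, -, rfl⟩ := Finset.mem_image.1 hb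
    refine Finset.mem_filter.2 ⟨Finset.mem_univ _, ?_⟩
    rw [← map_pow, ← hcu, pow_card_eq_one, map_one]
  have hcard : A.card ≤ B.card := by
    rw [Finset.card_image_of_injective _ hinj, Finset.card_univ, hcu]
    exact IsCyclic.card_pow_eq_one_le hpos
  have hxA : Units.mk0 x hx ∈ A :=
    Finset.mem_filter.2 ⟨Finset.mem_univ _, Units.ext (by simpa using h)⟩
  rw [← Finset.eq_of_subset_of_card_le hBA hcard] at hxA
  obtain ⟨c, -, hc⟩ := Finset.mem_image.1 hxA
  have : (c : K).1 = x := congrArg Units.val hc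
  exact this ▸ (c : K).2

/-- A function on residues mod `t` that is invariant under multiplication by `p` takes at most
`sOrb p t + 1` values. -/
theorem card_image_range_le_sOrb_add_one {p t : ℕ} (ht : 0 < t) (w : ℕ → ℕ)
    (hw : ∀ u < t, w u = w ((p * u) % t)) :
    ((Finset.range t).image w).card ≤ sOrb p t + 1 := by
  classical
  have : NeZero t := ⟨ht.ne'⟩
  let orb : ZMod t → Set (ZMod t) := fun x => {y | ∃ n : ℕ, y = (p : ZMod t) ^ n * x}
  let W : ZMod t → ℕ := fun x => w x.val
  have hstep (x : ZMod t) : W (p * x) = W x := by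
    simp only [W, ZMod.val_mul, ZMod.val_natCast, Nat.mod_mul_mod]
    exact (hw _ x.val_lt).symm
  have hpow (n : ℕ) (x : ZMod t) : W ((p : ZMod t) ^ n * x) = W x := by
    induction n with
    | zero => simp
    | succ k ih => rw [pow_succ', mul_assoc, hstep, ih]
  let f : Set (ZMod t) → ℕ := fun S => if hS : S.Nonempty then W hS.some else 0
  have hf (x : ZMod t) : f (orb x) = W x := by
    have hne : (orb x).Nonempty := ⟨x, 0, by simp⟩
    obtain ⟨n, hn⟩ := hne.some_mem
    simp only [f, dif_pos hne]
    rw [hn, hpow]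
  let T : Set (Set (ZMod t)) := {S | ∃ x : ZMod t, x ≠ 0 ∧ S = orb x}
  have hT : T.Finite := Set.toFinite T
  have hsub : (((Finset.range t).image w : Finset ℕ) : Set ℕ) ⊆ insert (w 0) (f '' T) := by
    intro m hm
    obtain ⟨u, hu, rfl⟩ := Finset.mem_image.1 (Finset.mem_coe.1 hm)
    have hut := Finset.mem_range.1 hu
    rcases Nat.eq_zero_or_pos u with rfl | hu0
    · exact Set.mem_insert _ _
    · have hval : (u : ZMod t).val = u := ZMod.val_cast_of_lt hut
      refine Set.mem_insert_of_mem _ ⟨orb u, ⟨u, fun h => ?_, rfl⟩, ?_⟩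
      · rw [h, ZMod.val_zero] at hval
        exact hu0.ne hval
      · simp only [hf, W, hval]
  calc ((Finset.range t).image w).card
      = (((Finset.range t).image w : Finset ℕ) : Set ℕ).ncard := (Set.ncard_coe_finset _).symm
    _ ≤ (insert (w 0) (f '' T)).ncard := Set.ncard_le_ncard hsub ((hT.image f).insert _)
    _ ≤ (f '' T).ncard + 1 := Set.ncard_insert_le _ _
    _ ≤ T.ncard + 1 := Nat.add_le_add_right (Set.ncard_image_le hT) 1

/-- In the Singer model, `α ^ i` and `α ^ j` represent the same point iff `i ≡ j (mod v)`. -/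
theorem span_pow_eq_span_pow_iff {q v : ℕ} (hv : v = q ^ 2 + q + 1) {F : Type*} [Field F] [Finite F]
    (hcard : Nat.card F = q ^ 3) (K : Subfield F) (hK : Nat.card K = q) {α : F} (hα : α ≠ 0)
    (hprim : ∀ x : F, x ≠ 0 → ∃ i : ℕ, α ^ i = x) (i j : ℕ) :
    Submodule.span K {α ^ i} = Submodule.span K {α ^ j} ↔ i ≡ j [MOD v] := by
  have hq : 1 < q := hK ▸ Finite.one_lt_card
  have hmul : v * (q - 1) = q ^ 3 - 1 := by
    obtain ⟨r, rfl⟩ : ∃ r, q = r + 1 := ⟨q - 1, by omega⟩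
    rw [hv, Nat.add_sub_cancel]
    refine (Nat.sub_eq_of_eq_add ?_).symm
    ring
  have hord : orderOf (Units.mk0 α hα) = v * (q - 1) := by
    rw [hmul, ← hcard, ← Nat.card_units]
    refine orderOf_eq_card_of_forall_mem_zpowers fun x => ?_
    obtain ⟨k, hk⟩ := hprim x x.ne_zero
    exact ⟨k, Units.ext (by simpa using hk)⟩
  have hpow (m n : ℕ) : α ^ m = α ^ n ↔ m ≡ n [MOD v * (q - 1)] := by
    rw [← hord, ← pow_eq_pow_iff_modEq, Units.ext_iff]
    simp
  have hspan (m n : ℕ) : Submodule.span K {α ^ (m + v * n)} = Submodule.span K {α ^ m} := by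
    have hmem : α ^ (v * n) ∈ K := by
      refine K.mem_of_pow_natCard_sub_one (pow_ne_zero _ hα) ?_
      rw [hK, ← pow_mul, ← pow_zero α, hpow, Nat.modEq_zero_iff_dvd]
      exact ⟨n, by ring⟩
    have hunit : IsUnit (⟨α ^ (v * n), hmem⟩ : K) :=
      isUnit_iff_ne_zero.2 fun h => pow_ne_zero (v * n) hα (congrArg Subtype.val h)
    rw [← Submodule.span_singleton_smul_eq hunit (α ^ m), Subfield.smul_def, smul_eq_mul,
      pow_add, mul_comm]
  have hmod (m : ℕ) : Submodule.span K {α ^ m} = Submodule.span K {α ^ (m % v)} := by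
    rw [← hspan (m % v) (m / v), Nat.mod_add_div]
  constructor
  · intro h
    obtain ⟨c, hc⟩ := Submodule.mem_span_singleton.1
      (h ▸ Submodule.mem_span_singleton_self (α ^ i) : α ^ i ∈ Submodule.span K {α ^ j})
    rw [Subfield.smul_def, smul_eq_mul] at hc
    have hc0 : c ≠ 0 := by
      rintro rfl
      exact pow_ne_zero i hα (by simpa using hc.symm)
    have := Fintype.ofFinite K
    have hc1 : (c : F) ^ (q - 1) = 1 := by
      have := FiniteField.pow_card_sub_one_eq_one c hc0
      rw [← Nat.card_eq_fintype_card, hK] at this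
      exact_mod_cast congrArg Subtype.val this
    have he : α ^ (i * (q - 1)) = α ^ (j * (q - 1)) := by
      rw [pow_mul, ← hc, mul_pow, hc1, one_mul, pow_mul]
    exact Nat.ModEq.mul_right_cancel' (by omega) ((hpow _ _).1 he)
  · intro h
    rw [hmod i, hmod j, h]

/-- Singer model of `PG(2,q)`, `q = p^h`, `v = q²+q+1 = d·t`, point orbits
`O u = {Pt i | i ≡ u (mod t)}` of `σ^t`.  Suppose the line `ℓ0` is left invariant by
the collineation `τ : P_i ↦ P_{(i·p) mod v}` and set `w u = |ℓ0 ∩ O u|`.  Then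
`w u = w ((p·u) mod t)` for every `u`, and consequently the number of distinct values
among `w 0, …, w (t-1)` is at most `sOrb p t + 1`. -/
theorem stmt8
    (p h q v : ℕ) (hp : p.Prime) (hh : 1 ≤ h) (hq : q = p ^ h)
    (hv : v = q ^ 2 + q + 1)
    (F : Type) [Field F] [Fintype F] (hcard : Nat.card F = q ^ 3)
    (Fq : Subfield F) (hcardq : Nat.card Fq = q)
    (α : F) (hα : α ≠ 0) (hprim : ∀ x : F, x ≠ 0 → ∃ i : ℕ, α ^ i = x)
    (Pt : ℕ → Submodule Fq F) (hPt : ∀ i : ℕ, Pt i = Submodule.span Fq {α ^ i})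
    (d t : ℕ) (hd : 0 < d) (hdt : v = d * t)
    (O : ℕ → Set (Submodule Fq F))
    (hO : ∀ u : ℕ, O u = {P : Submodule Fq F | ∃ i : ℕ, i % t = u % t ∧ P = Pt i})
    (ℓ0 : Submodule Fq F) (hline : Module.finrank Fq ℓ0 = 2)
    (w : ℕ → ℕ)
    (hw : ∀ u : ℕ, w u = {P : Submodule Fq F | P ∈ O u ∧ P ≤ ℓ0}.ncard)
    (hinv : ∀ i : ℕ, α ^ i ∈ ℓ0 ↔ α ^ ((i * p) % v) ∈ ℓ0)
    :
    (∀ u : ℕ, u < t → w u = w ((p * u) % t)) ∧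
    ((Finset.range t).image w).card ≤ sOrb p t + 1 := by
  have hiff := span_pow_eq_span_pow_iff hv hcard Fq hcardq hα hprim
  have hv1 : 1 < v := by
    have : 0 < q := hq ▸ pow_pos hp.pos h
    omega
  have hv0 : 0 < v := by omega
  have ht : 0 < t := Nat.pos_of_mul_pos_left (hdt ▸ hv0)
  have htv : t ∣ v := hdt ▸ dvd_mul_left t d
  have hpv : Nat.Coprime p v := by
    have hpq : p ∣ q ^ 2 + q := by
      have : p ∣ q := hq ▸ dvd_pow_self p (by omega)
      exact dvd_add (dvd_pow this two_ne_zero) this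
    rw [hp.coprime_iff_not_dvd, hv, Nat.dvd_add_right hpq]
    exact hp.not_dvd_one
  have hpt : Nat.gcd t p = 1 := (hpv.coprime_dvd_right htv).symm
  have hle (i : ℕ) : Pt i ≤ ℓ0 ↔ α ^ i ∈ ℓ0 := by
    rw [hPt, Submodule.span_singleton_le_iff_mem]
  have hPtmod (i : ℕ) : Pt (i % v) = Pt i := by
    rw [hPt, hPt, hiff]
    exact Nat.mod_modEq i v
  have hinv' (i : ℕ) : Pt i ≤ ℓ0 ↔ Pt (i * p) ≤ ℓ0 := by
    rw [← hPtmod (i * p), hle, hle, hinv]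
  let I : ℕ → Set ℕ := fun u => {i | i < v ∧ i ≡ u [MOD t] ∧ Pt i ≤ ℓ0}
  have hwI (u : ℕ) : w u = (I u).ncard := by
    rw [hw]
    symm
    refine Set.ncard_congr (fun i _ => Pt i) ?_ ?_ ?_
    · rintro i ⟨-, hiu, hi⟩
      rw [Set.mem_ofPred_eq, hO]
      exact ⟨⟨i, hiu, rfl⟩, hi⟩
    · rintro i j ⟨hi, -⟩ ⟨hj, -⟩ hij
      rw [hPt, hPt, hiff] at hij
      exact hij.eq_of_lt_of_lt hi hj
    · rintro P ⟨hPO, hP⟩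
      rw [hO] at hPO
      obtain ⟨i, hiu, rfl⟩ := hPO
      refine ⟨i % v, ⟨Nat.mod_lt _ hv0, ?_, ?_⟩, hPtmod i⟩
      · exact ((Nat.mod_modEq i v).of_dvd htv).trans hiu
      · rwa [hPtmod]
  have hinvariant (u : ℕ) : w u = w ((p * u) % t) := by
    rw [hwI, hwI]
    refine Set.ncard_congr (fun i _ => (i * p) % v) ?_ ?_ ?_
    · rintro i ⟨-, hiu, hi⟩
      refine ⟨Nat.mod_lt _ hv0, ?_, ?_⟩
      · refine ((Nat.mod_modEq _ v).of_dvd htv).trans ?_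
        rw [mul_comm p u]
        exact (hiu.mul_right p).trans (Nat.mod_modEq _ t).symm
      · rwa [hPtmod, ← hinv']
    · rintro i j ⟨hi, -⟩ ⟨hj, -⟩ hij
      exact (Nat.ModEq.cancel_right_of_coprime hpv.symm hij).eq_of_lt_of_lt hi hj
    · rintro j ⟨hj, hju, hjl⟩
      obtain ⟨r, hr⟩ : ∃ r, p * r ≡ 1 [MOD v] := by
        obtain ⟨r, -, hr⟩ := Nat.exists_mul_mod_eq_one_of_coprime hpv hv1
        exact ⟨r, hr.trans (Nat.mod_eq_of_lt hv1).symm⟩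
      have hjr : (j * r) % v * p ≡ j [MOD v] :=
        calc (j * r) % v * p ≡ j * r * p [MOD v] := (Nat.mod_modEq _ v).mul_right p
          _ = j * (p * r) := by ring
          _ ≡ j * 1 [MOD v] := hr.mul_left j
          _ = j := mul_one j
      have hback : ((j * r) % v * p) % v = j := by
        rw [hjr, Nat.mod_eq_of_lt hj]
      refine ⟨(j * r) % v, ⟨Nat.mod_lt _ hv0, ?_, ?_⟩, hback⟩
      · refine Nat.ModEq.cancel_right_of_coprime hpt ?_
        rw [mul_comm u p]
        exact ((hjr.of_dvd htv).trans hju).trans (Nat.mod_modEq _ t)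
      · rwa [hinv', ← hPtmod, hback]
  exact ⟨fun u _ => hinvariant u,
    card_image_range_le_sOrb_add_one ht w fun u _ => hinvariant u⟩
end

section
/- In the Singer model of PG(2,q) with q = p^h (p prime), v = q²+q+1, d a divisor of v, t = v/d prime, point orbits O_0,…,O_{t−1} of the subgroup generated by σ^t, with ℓ_0 a line invariant under τ : P_i ↦ P_{(ip) mod v} and w_u = |ℓ_0 ∩ O_u|: let s = s(p,t) and let i_1,…,i_s ∈ {1,…,t−1} be representatives of the s orbits of Z_t ∖ {0} under the permutation group generated by i ↦ p·i (mod t). Then w_0 + ((t−1)/s)·Σ_{j=1}^{s} w_{i_j} = q + 1 and w_0² + ((t−1)/s)·Σ_{j=1}^{s} w_{i_j}² = (q² + (t+1)q + 1)/t. -/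
open Finset in
/-- If `I` represents the orbits of multiplication by `p` on `ZMod t \ {0}`, then averaging an
invariant function over `I` is the same as averaging it over all nonzero residues. -/
lemma sum_orbit_representatives {t : ℕ} (ht : t.Prime) {p : ℕ} (hp : (p : ZMod t) ≠ 0)
    (I : Finset ℕ) (hIrange : ∀ i ∈ I, 1 ≤ i ∧ i ≤ t - 1)
    (hIrep : ∀ u : ℕ, 1 ≤ u → u ≤ t - 1 →
      ∃! i, i ∈ I ∧ ∃ n : ℕ, (u : ZMod t) = (p : ZMod t) ^ n * (i : ZMod t))
    [Fintype (ZMod t)] (f : ZMod t → ℕ) (hf : ∀ a, f (p * a) = f a) :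
    (t - 1) * ∑ i ∈ I, f i = #I * ∑ a ∈ univ.erase (0 : ZMod t), f a := by
  have : Fact t.Prime := ⟨ht⟩
  set m := orderOf (p : ZMod t) with hm
  have hm0 : 0 < m := orderOf_pos_iff.mpr (isOfFinOrder_iff_isUnit.mpr hp.isUnit)
  have hIne : ∀ i ∈ I, (i : ZMod t) ≠ 0 := by
    intro i hi h0
    rw [ZMod.natCast_eq_zero_iff] at h0
    have := Nat.le_of_dvd (hIrange i hi).1 h0
    have := hIrange i hi
    omega
  have key : ∀ g : ZMod t → ℕ, (∀ a, g (p * a) = g a) →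
      ∑ a ∈ univ.erase (0 : ZMod t), g a = m * ∑ i ∈ I, g i := by
    intro g hg
    have hgn : ∀ n a, g (p ^ n * a) = g a := by
      intro n a
      induction n with
      | zero => simp
      | succ n ih => rw [pow_succ', mul_assoc, hg, ih]
    calc ∑ a ∈ univ.erase (0 : ZMod t), g a
        = ∑ x ∈ I ×ˢ range m, g ((p : ZMod t) ^ x.2 * x.1) := by
          symm
          refine sum_nbij (fun x : ℕ × ℕ => (p : ZMod t) ^ x.2 * (x.1 : ZMod t)) ?_ ?_ ?_ ?_
          · rintro ⟨i, n⟩ hx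
            rw [mem_product] at hx
            simpa using ⟨fun h => absurd h hp, hIne i hx.1⟩
          · rintro ⟨i, n⟩ hx ⟨j, k⟩ hy hxy
            simp only [coe_product, Set.mem_prod, mem_coe, mem_range] at hx hy hxy
            set b := (p : ZMod t) ^ n * (i : ZMod t) with hb
            have hb0 : b ≠ 0 := mul_ne_zero (pow_ne_zero _ hp) (hIne i hx.1)
            have hv0 : b.val ≠ 0 := by rwa [Ne, ZMod.val_eq_zero]
            have hvt := b.val_lt
            obtain ⟨l, -, hl⟩ := hIrep b.val (by omega) (by omega)
            have hbv : ((b.val : ℕ) : ZMod t) = b := ZMod.natCast_zmod_val b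
            have hi := hl i ⟨hx.1, n, hbv.trans hb⟩
            have hj := hl j ⟨hy.1, k, hbv.trans hxy⟩
            have hij : i = j := hi.trans hj.symm
            subst hij
            have := mul_right_cancel₀ (hIne i hx.1) (hb.symm.trans hxy)
            rw [pow_injOn_Iio_orderOf hx.2 hy.2 this]
          · intro b hb
            have hb0 : b ≠ 0 := by simpa using hb
            have hv0 : b.val ≠ 0 := by rwa [Ne, ZMod.val_eq_zero]
            have hvt := b.val_lt
            obtain ⟨i, ⟨hi, n, hn⟩, -⟩ := hIrep b.val (by omega) (by omega)
            refine ⟨(i, n % m), ?_, ?_⟩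
            · simpa using ⟨hi, Nat.mod_lt _ hm0⟩
            · simp only
              rw [pow_mod_orderOf, ← hn, ZMod.natCast_zmod_val]
          · simp
      _ = m * ∑ i ∈ I, g i := by
          rw [sum_product, mul_sum]
          simp [hgn]
  have h1 := key (fun _ => 1) (fun _ => rfl)
  simp only [sum_const, smul_eq_mul, mul_one, card_erase_of_mem (mem_univ _), card_univ,
    ZMod.card] at h1
  rw [key f hf, h1]
  ring

/-- For a plane `ℓ` in a cubic extension `F / K` and `z ∉ K`, the planes `ℓ` and `z⁻¹ ℓ` meet in a
one-dimensional space. -/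
lemma finrank_inf_comap_mulLeft {K F : Type*} [Field K] [Field F] [Algebra K F]
    (h3 : Module.finrank K F = 3) {ℓ : Submodule K F} (hℓ : Module.finrank K ℓ = 2)
    {z : F} (hz : z ∉ Set.range (algebraMap K F)) :
    Module.finrank K ↥(ℓ ⊓ ℓ.comap (LinearMap.mulLeft K z)) = 1 := by
  have hfin : FiniteDimensional K F := Module.finite_of_finrank_pos (by omega)
  have hz0 : z ≠ 0 := by
    rintro rfl
    exact hz ⟨0, map_zero _⟩
  set M := ℓ.comap (LinearMap.mulLeft K z) with hM
  have hM2 : Module.finrank K M = 2 := by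
    have hker : LinearMap.ker (LinearMap.mulLeft K z) = ⊥ :=
      LinearMap.ker_eq_bot.mpr (mul_right_injective₀ hz0)
    have hrange : LinearMap.range (LinearMap.mulLeft K z) = ⊤ :=
      LinearMap.range_eq_top.mpr (mul_left_surjective₀ hz0)
    have hmap : M.map (LinearMap.mulLeft K z) = ℓ := by
      rw [hM, Submodule.map_comap_eq, hrange, top_inf_eq]
    rw [← hℓ, ← hmap]
    exact (LinearEquiv.finrank_eq
      (Submodule.equivMapOfInjective _ (LinearMap.ker_eq_bot.mp hker) M))
  have hsum := Submodule.finrank_sup_add_finrank_inf_eq ℓ M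
  have hle : Module.finrank K ↥(ℓ ⊔ M) ≤ 3 := h3 ▸ Submodule.finrank_le _
  have hinf : Module.finrank K ↥(ℓ ⊓ M) ≤ 2 := hℓ ▸ Submodule.finrank_mono inf_le_left
  suffices Module.finrank K ↥(ℓ ⊓ M) ≠ 2 by omega
  intro h2
  have hEq : ℓ ⊓ M = ℓ := Submodule.eq_of_le_of_finrank_eq inf_le_left (h2.trans hℓ.symm)
  have hstab : ∀ y ∈ ℓ, z * y ∈ ℓ := fun y hy => inf_eq_left.mp hEq hy
  let S : Subalgebra K F :=
    { carrier := {x | ∀ y ∈ ℓ, x * y ∈ ℓ}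
      mul_mem' := fun {a b} ha hb y hy => by
        rw [mul_assoc]
        exact ha _ (hb y hy)
      add_mem' := fun {a b} ha hb y hy => by
        rw [add_mul]
        exact ℓ.add_mem (ha y hy) (hb y hy)
      algebraMap_mem' := fun r y hy => by
        rw [← Algebra.smul_def]
        exact ℓ.smul_mem r hy }
  have hsimple : IsSimpleOrder (Subalgebra K F) :=
    Subalgebra.isSimpleOrder_of_finrank_prime K F (h3 ▸ Nat.prime_three)
  have hzS : z ∈ S := hstab
  rcases eq_bot_or_eq_top S with hS | hS
  · rw [hS, Algebra.mem_bot] at hzS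
    exact hz hzS
  · have hne : ℓ ≠ ⊥ := by
      rintro rfl
      simp at hℓ
    obtain ⟨y, hy, hy0⟩ := Submodule.exists_mem_ne_zero_of_ne_bot hne
    have htop : ℓ = ⊤ := by
      rw [eq_top_iff]
      intro x _
      have hx : x * y⁻¹ ∈ S := hS ▸ Algebra.mem_top
      simpa [mul_assoc, hy0] using hx y hy
    rw [htop, finrank_top] at hℓ
    omega

lemma card_nonzero_mem {K F : Type*} [Field K] [Field F] [Algebra K F] [Fintype F]
    [DecidableEq F] (ℓ : Submodule K F) [DecidablePred (· ∈ ℓ)] :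
    (Finset.univ.filter fun x : F => x ≠ 0 ∧ x ∈ ℓ).card
      = Nat.card K ^ Module.finrank K ℓ - 1 := by
  have h1 : Nat.card ℓ = Nat.card K ^ Module.finrank K ℓ := Module.natCard_eq_pow_finrank
  have h2 : (Finset.univ.filter fun x : F => x ∈ ℓ).card = Nat.card ℓ := by
    rw [Nat.card_eq_fintype_card, Fintype.card_subtype]
  rw [← h1, ← h2, ← Finset.card_erase_of_mem (a := (0 : F)) (by simp)]
  congr 1
  ext x
  simp

open Finset in
/-- Second moment of the distribution of the nonzero vectors of a plane in a cubic extension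
among the fibres of a homomorphism `c` which is trivial on the base field. -/
lemma sum_sq_card_fiber {K F A : Type*} [Field K] [Field F] [Algebra K F] [Fintype F]
    [DecidableEq F] [AddGroup A] [Fintype A] [DecidableEq A]
    (h3 : Module.finrank K F = 3) {ℓ : Submodule K F} [DecidablePred (· ∈ ℓ)]
    (hℓ : Module.finrank K ℓ = 2) (c : F → A)
    (hc : ∀ x y, x ≠ 0 → y ≠ 0 → c (x * y) = c x + c y)
    (hK : ∀ k : K, k ≠ 0 → c (algebraMap K F k) = 0) :
    ∑ a : A, #{x : F | (x ≠ 0 ∧ x ∈ ℓ) ∧ c x = a} ^ 2 + (Nat.card K - 1) ^ 2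
      = (Nat.card K - 1) * (Nat.card K ^ 2 - 1)
        + #{z : F | z ≠ 0 ∧ c z = 0} * (Nat.card K - 1) := by
  classical
  set L : Finset F := {x : F | x ≠ 0 ∧ x ∈ ℓ} with hL
  set H : Finset F := {z : F | z ≠ 0 ∧ c z = 0} with hH
  set P : Finset (F × F) := {x ∈ L ×ˢ L | c x.1 = c x.2} with hP
  have hPA : #P = ∑ a : A, #{x : F | (x ≠ 0 ∧ x ∈ ℓ) ∧ c x = a} ^ 2 := by
    rw [card_eq_sum_card_fiberwise (f := fun x : F × F => c x.1) (t := univ) (by simp)]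
    refine sum_congr rfl fun a _ => ?_
    rw [sq, ← card_product]
    congr 1
    ext ⟨x, y⟩
    simp only [hP, hL, mem_filter, mem_product, mem_univ, true_and]
    constructor
    · rintro ⟨⟨⟨h1, h2⟩, h3⟩, h4⟩
      exact ⟨⟨h1, h4⟩, h2, h3 ▸ h4⟩
    · rintro ⟨⟨h1, h4⟩, h2, h3⟩
      exact ⟨⟨⟨h1, h2⟩, h4.trans h3.symm⟩, h4⟩
  have hPH : #P = ∑ z ∈ H, #{y ∈ L | z * y ∈ ℓ} := by
    rw [card_eq_sum_card_fiberwise (f := fun x : F × F => x.1 / x.2) (t := H)]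
    · refine sum_congr rfl fun z hz => ?_
      simp only [hH, mem_filter, mem_univ, true_and] at hz
      refine card_nbij' (fun x => x.2) (fun y => (z * y, y)) ?_ ?_ ?_ ?_
      · rintro ⟨x, y⟩ hx
        simp only [hP, hL, mem_filter, mem_product, mem_univ, true_and, coe_filter,
          Set.mem_ofPred_eq] at hx ⊢
        obtain ⟨⟨⟨⟨hx0, hx⟩, hy0, hy⟩, hxy⟩, rfl⟩ := hx
        rw [div_mul_cancel₀ _ hy0]
        exact ⟨⟨hy0, hy⟩, hx⟩
      · intro y hy
        simp only [hP, hL, mem_filter, mem_product, mem_univ, true_and, coe_filter,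
          Set.mem_ofPred_eq] at hy ⊢
        obtain ⟨⟨hy0, hy⟩, hzy⟩ := hy
        refine ⟨⟨⟨⟨mul_ne_zero hz.1 hy0, hzy⟩, hy0, hy⟩, ?_⟩, mul_div_cancel_right₀ _ hy0⟩
        rw [hc z y hz.1 hy0, hz.2, zero_add]
      · rintro ⟨x, y⟩ hx
        simp only [hP, hL, mem_filter, mem_product, mem_univ, true_and, coe_filter,
          Set.mem_ofPred_eq] at hx ⊢
        obtain ⟨⟨⟨⟨hx0, hx⟩, hy0, hy⟩, hxy⟩, rfl⟩ := hx
        rw [div_mul_cancel₀ _ hy0]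
      · intro y hy
        rfl
    · rintro ⟨x, y⟩ hx
      simp only [hP, hH, hL, mem_filter, mem_product, mem_univ, true_and, coe_filter,
        Set.mem_ofPred_eq] at hx ⊢
      obtain ⟨⟨⟨hx0, hx⟩, hy0, hy⟩, hxy⟩ := hx
      refine ⟨div_ne_zero hx0 hy0, ?_⟩
      have h := hc (x / y) y (div_ne_zero hx0 hy0) hy0
      rw [div_mul_cancel₀ _ hy0, hxy] at h
      simpa using h.symm
  have hLcard : #L = Nat.card K ^ 2 - 1 := by rw [hL, card_nonzero_mem, hℓ]
  set B : Finset F := {z : F | z ≠ 0 ∧ z ∈ (1 : Submodule K F)} with hB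
  have hBcard : #B = Nat.card K - 1 := by
    have : Module.finrank K (1 : Submodule K F) = 1 := by
      rw [Submodule.one_eq_span]
      exact finrank_span_singleton one_ne_zero
    rw [hB, card_nonzero_mem, this, pow_one]
  have hBH : B ⊆ H := by
    intro z hz
    simp only [hB, hH, mem_filter, mem_univ, true_and, Submodule.mem_one] at hz ⊢
    obtain ⟨hz0, k, rfl⟩ := hz
    exact ⟨hz0, hK k (by rintro rfl; simp at hz0)⟩
  have hin : ∀ z ∈ B, #{y ∈ L | z * y ∈ ℓ} = Nat.card K ^ 2 - 1 := by
    intro z hz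
    simp only [hB, mem_filter, mem_univ, true_and, Submodule.mem_one] at hz
    obtain ⟨hz0, k, rfl⟩ := hz
    rw [← hLcard, filter_true_of_mem]
    intro y hy
    rw [← Algebra.smul_def]
    simp only [hL, mem_filter, mem_univ, true_and] at hy
    exact ℓ.smul_mem k hy.2
  have hout : ∀ z ∈ H \ B, #{y ∈ L | z * y ∈ ℓ} = Nat.card K - 1 := by
    intro z hz
    simp only [hB, hH, mem_sdiff, mem_filter, mem_univ, true_and, Submodule.mem_one] at hz
    have h1 := finrank_inf_comap_mulLeft h3 hℓ (z := z) fun h => hz.2 ⟨hz.1.1, h⟩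
    have h2 := card_nonzero_mem (ℓ ⊓ ℓ.comap (LinearMap.mulLeft K z))
    rw [h1, pow_one] at h2
    rw [← h2]
    congr 1
    ext y
    simp [hL, and_assoc]
  rw [← hPA, hPH, ← sum_sdiff hBH, sum_congr rfl hin, sum_congr rfl hout, sum_const, sum_const,
    ← card_sdiff_add_card_eq_card hBH, hBcard]
  simp only [smul_eq_mul]
  ring

/-- The nonzero elements of a finite subfield with `q` elements are exactly the `(q - 1)`-st roots
of unity. -/
lemma Subfield.mem_of_pow_eq_one {F : Type*} [Field F] (k : Subfield F) [Finite k] {x : F}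
    (hx : x ^ (Nat.card k - 1) = 1) : x ∈ k := by
  classical
  have : Fintype k := Fintype.ofFinite k
  have hpos : 0 < Nat.card k - 1 := Nat.sub_pos_of_lt Finite.one_lt_card
  let S : Finset F := (Finset.univ.erase (0 : k)).map ⟨Subtype.val, Subtype.val_injective⟩
  have hS : S ⊆ (Polynomial.nthRoots (Nat.card k - 1) (1 : F)).toFinset := by
    intro y hy
    simp only [S, Finset.mem_map, Finset.mem_erase, Finset.mem_univ, and_true,
      Function.Embedding.coeFn_mk] at hy
    obtain ⟨z, hz, rfl⟩ := hy
    rw [Multiset.mem_toFinset, Polynomial.mem_nthRoots hpos, Nat.card_eq_fintype_card]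
    exact_mod_cast FiniteField.pow_card_sub_one_eq_one z hz
  have hcard : S.card = Nat.card k - 1 := by
    simp [S, Finset.card_erase_of_mem, Nat.card_eq_fintype_card]
  have hEq := Finset.eq_of_subset_of_card_le hS <| by
    rw [hcard]
    exact (Multiset.toFinset_card_le _).trans (Polynomial.card_nthRoots _ _)
  have hxS : x ∈ S := by
    rw [hEq, Multiset.mem_toFinset, Polynomial.mem_nthRoots hpos, hx]
  simp only [S, Finset.mem_map, Function.Embedding.coeFn_mk] at hxS
  obtain ⟨z, -, rfl⟩ := hxS
  exact z.2

/-- All fibres of a surjective homomorphism from the nonzero elements of a finite field have the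
same size. -/
lemma card_mul_card_fiber_zero {F A : Type*} [Field F] [Fintype F] [DecidableEq F] [AddGroup A]
    [Fintype A] [DecidableEq A] (c : F → A)
    (hc : ∀ x y, x ≠ 0 → y ≠ 0 → c (x * y) = c x + c y)
    (hsurj : ∀ a, ∃ x, x ≠ 0 ∧ c x = a) :
    Fintype.card A * (Finset.univ.filter fun z : F => z ≠ 0 ∧ c z = 0).card
      = Nat.card F - 1 := by
  have h1 : (Finset.univ.erase (0 : F)).card = Nat.card F - 1 := by
    rw [Finset.card_erase_of_mem (Finset.mem_univ _), Finset.card_univ, Nat.card_eq_fintype_card]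
  rw [← h1, Finset.card_eq_sum_card_fiberwise (s := Finset.univ.erase (0 : F)) (f := c)
    (t := Finset.univ) (by simp), ← Finset.card_univ]
  refine (Finset.sum_const_nat fun a _ => ?_).symm
  obtain ⟨x, hx0, rfl⟩ := hsurj a
  symm
  refine Finset.card_nbij' (fun z => x * z) (fun z => x⁻¹ * z) ?_ ?_ ?_ ?_
  · intro z hz
    simp only [Finset.coe_filter, Finset.mem_univ, true_and, Set.mem_ofPred_eq] at hz
    simp [hc x z hx0 hz.1, hz.2, hx0, hz.1]
  · intro z hz
    simp only [Finset.coe_filter, Finset.mem_erase, Finset.mem_univ, and_true,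
      Set.mem_ofPred_eq] at hz
    have h := hc x (x⁻¹ * z) hx0 (mul_ne_zero (inv_ne_zero hx0) hz.1)
    rw [mul_inv_cancel_left₀ hx0, hz.2] at h
    simpa [hx0, hz.1] using h
  · intro z _
    exact inv_mul_cancel_left₀ hx0 z
  · intro z _
    exact mul_inv_cancel_left₀ hx0 z

/-- Each one-dimensional subspace has `|K| - 1` nonzero vectors, so a set of nonzero vectors stable
under scalars is `|K| - 1` times as large as the set of lines it spans. -/
lemma card_filter_eq_mul_ncard_span {K F : Type*} [Field K] [AddCommGroup F] [Module K F]
    [Fintype F] (S : Finset F) (h0 : 0 ∉ S)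
    (hS : ∀ k : K, k ≠ 0 → ∀ x ∈ S, k • x ∈ S) :
    S.card = (Nat.card K - 1) * ((fun x : F => Submodule.span K {x}) '' (S : Set F)).ncard := by
  classical
  rw [← Finset.coe_image, Set.ncard_coe_finset, mul_comm, ← smul_eq_mul, ← Finset.sum_const,
    Finset.card_eq_sum_card_image (fun x : F => Submodule.span K {x})]
  refine Finset.sum_congr rfl fun P hP => ?_
  obtain ⟨x, hx, rfl⟩ := Finset.mem_image.mp hP
  have hx0 : x ≠ 0 := fun h => h0 (h ▸ hx)
  have : Finite K := Finite.of_injective (fun k : K => k • x) (smul_left_injective K hx0)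
  have : Fintype K := Fintype.ofFinite K
  rw [Nat.card_eq_fintype_card, ← Finset.card_univ, ← Finset.card_erase_of_mem (Finset.mem_univ 0)]
  symm
  refine Finset.card_nbij (fun k : K => k • x) ?_ (smul_left_injective K hx0).injOn ?_
  · intro k hk
    have hk0 : k ≠ 0 := by simpa using hk
    simp only [Finset.coe_filter, Set.mem_ofPred_eq]
    exact ⟨hS k hk0 x hx, Submodule.span_singleton_smul_eq hk0.isUnit x⟩
  · intro y hy
    simp only [Finset.coe_filter, Set.mem_ofPred_eq] at hy
    have hyx : y ∈ Submodule.span K {x} := hy.2 ▸ Submodule.mem_span_singleton_self y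
    obtain ⟨k, rfl⟩ := Submodule.mem_span_singleton.mp hyx
    refine ⟨k, ?_, rfl⟩
    have : k ≠ 0 := by
      rintro rfl
      exact h0 (by simpa using hy.1)
    simpa using this


/-- Singer model of `PG(2,q)`, `v = q²+q+1 = d·t` with `t` prime, `ℓ0` a line invariant
under `τ : P_i ↦ P_{(i·p) mod v}`, `w u = |ℓ0 ∩ O u|`.  Let `s = sOrb p t` and let
`I ⊆ {1, …, t-1}` be a set of representatives of the `s` orbits of `Z_t \\ {0}` under
multiplication by `p`.  Then `w 0 + ((t-1)/s)·Σ_{i ∈ I} w i = q + 1` and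
`w 0² + ((t-1)/s)·Σ_{i ∈ I} (w i)² = (q² + (t+1)q + 1)/t` (both stated multiplied
through by `s`, resp. by `s·t`). -/
theorem stmt10
    (p h q v : ℕ) (hp : p.Prime) (hh : 1 ≤ h) (hq : q = p ^ h)
    (hv : v = q ^ 2 + q + 1)
    (F : Type) [Field F] [Fintype F] (hcard : Nat.card F = q ^ 3)
    (Fq : Subfield F) (hcardq : Nat.card Fq = q)
    (α : F) (hα : α ≠ 0) (hprim : ∀ x : F, x ≠ 0 → ∃ i : ℕ, α ^ i = x)
    (Pt : ℕ → Submodule Fq F) (hPt : ∀ i : ℕ, Pt i = Submodule.span Fq {α ^ i})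
    (d t : ℕ) (hd : 0 < d) (hdt : v = d * t)
    (O : ℕ → Set (Submodule Fq F))
    (hO : ∀ u : ℕ, O u = {P : Submodule Fq F | ∃ i : ℕ, i % t = u % t ∧ P = Pt i})
    (ℓ0 : Submodule Fq F) (hline : Module.finrank Fq ℓ0 = 2)
    (w : ℕ → ℕ)
    (hw : ∀ u : ℕ, w u = {P : Submodule Fq F | P ∈ O u ∧ P ≤ ℓ0}.ncard)
    (hinv : ∀ i : ℕ, α ^ i ∈ ℓ0 ↔ α ^ ((i * p) % v) ∈ ℓ0)
    (ht : t.Prime)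
    (s : ℕ) (hs : s = sOrb p t)
    (I : Finset ℕ) (hIcard : I.card = s)
    (hIrange : ∀ i ∈ I, 1 ≤ i ∧ i ≤ t - 1)
    (hIrep : ∀ u : ℕ, 1 ≤ u → u ≤ t - 1 →
      ∃! i, i ∈ I ∧ ∃ n : ℕ, (u : ZMod t) = (p : ZMod t) ^ n * (i : ZMod t))
    :
    s * w 0 + (t - 1) * (∑ i ∈ I, w i) = s * (q + 1) ∧
    t * (s * (w 0) ^ 2 + (t - 1) * (∑ i ∈ I, (w i) ^ 2))
      = s * (q ^ 2 + (t + 1) * q + 1) := by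
  classical
  have : Fact t.Prime := ⟨ht⟩
  have hq2 : 2 ≤ q := by
    rw [hq]
    exact hp.two_le.trans (Nat.le_self_pow (by omega) p)
  obtain ⟨r, rfl⟩ : ∃ r, q = r + 1 := ⟨q - 1, by omega⟩
  have hr : 0 < r := by omega
  have hcubic : (r + 1) ^ 3 - 1 = r * v := by
    rw [hv]
    have : (r + 1) ^ 3 = r * ((r + 1) ^ 2 + (r + 1) + 1) + 1 := by ring
    omega
  have htv : t ∣ v := ⟨d, by rw [hdt, mul_comm]⟩
  have hv0 : 0 < v := by rw [hv]; positivity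
  have hpt : (p : ZMod t) ≠ 0 := by
    rw [Ne, ZMod.natCast_eq_zero_iff, Nat.prime_dvd_prime_iff_eq ht hp]
    rintro rfl
    have hdvd : t ∣ r + 1 := hq ▸ dvd_pow_self t (by omega)
    have : t ∣ 1 := by
      rw [hv, sq] at htv
      exact (Nat.dvd_add_right (dvd_add (hdvd.mul_left _) hdvd)).mp htv
    exact ht.one_lt.ne' (Nat.dvd_one.mp this)
  have hrank : Module.finrank Fq F = 3 := by
    have h := Module.natCard_eq_pow_finrank (K := Fq) (V := F)
    rw [hcard, hcardq] at h
    exact (Nat.pow_right_injective hq2 h).symm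
  have horder : orderOf α = r * v := by
    have h := orderOf_eq_card_of_forall_mem_zpowers (g := Units.mk0 α hα) fun x => by
      obtain ⟨i, hi⟩ := hprim x x.ne_zero
      exact ⟨i, Units.ext (by simpa using hi)⟩
    rw [← orderOf_units, Units.val_mk0, Nat.card_units, hcard, hcubic] at h
    exact h
  have hαv : α ^ v ∈ Fq := by
    apply Subfield.mem_of_pow_eq_one
    rw [hcardq, Nat.add_sub_cancel, ← pow_mul, mul_comm, ← horder, pow_orderOf_eq_one]
  have hmodt : ∀ i j : ℕ, α ^ i = α ^ j → (i : ZMod t) = j := by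
    intro i j hij
    have hfin : IsOfFinOrder α := orderOf_pos_iff.mp (by rw [horder]; positivity)
    rw [hfin.pow_eq_pow_iff_modEq, horder] at hij
    exact (ZMod.natCast_eq_natCast_iff _ _ _).mpr (hij.of_dvd (htv.mul_left r))
  obtain ⟨c, hcα⟩ : ∃ c : F → ZMod t, ∀ i : ℕ, c (α ^ i) = i := by
    choose! e he using hprim
    exact ⟨fun x => e x, fun i => hmodt _ _ (he _ (pow_ne_zero _ hα))⟩
  have hc : ∀ x y, x ≠ 0 → y ≠ 0 → c (x * y) = c x + c y := by
    intro x y hx hy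
    obtain ⟨i, rfl⟩ := hprim x hx
    obtain ⟨j, rfl⟩ := hprim y hy
    rw [← pow_add, hcα, hcα, hcα, Nat.cast_add]
  have hcK : ∀ k : Fq, k ≠ 0 → c (algebraMap Fq F k) = 0 := by
    intro k hk
    have : Fintype Fq := Fintype.ofFinite Fq
    have h1 : (k : F) ^ r = 1 := by
      have h := FiniteField.pow_card_sub_one_eq_one k hk
      rw [← Nat.card_eq_fintype_card, hcardq, Nat.add_sub_cancel] at h
      exact_mod_cast h
    obtain ⟨i, hi⟩ := hprim k (by simpa using hk)
    change c (k : F) = 0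
    rw [← hi, ← pow_mul, ← orderOf_dvd_iff_pow_eq_one, horder, mul_comm] at h1
    rw [← hi, hcα, ZMod.natCast_eq_zero_iff]
    exact htv.trans (Nat.dvd_of_mul_dvd_mul_right hr h1)
  have hcsurj : ∀ a, ∃ x, x ≠ 0 ∧ c x = a := fun a =>
    ⟨α ^ a.val, pow_ne_zero _ hα, by rw [hcα, ZMod.natCast_zmod_val]⟩
  set N : ZMod t → ℕ := fun a =>
    (Finset.univ.filter fun x : F => (x ≠ 0 ∧ x ∈ ℓ0) ∧ c x = a).card with hN
  have hwN : ∀ u : ℕ, N u = r * w u := by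
    intro u
    rw [hN, hw]
    simp only
    rw [card_filter_eq_mul_ncard_span (K := Fq), hcardq, Nat.add_sub_cancel]
    · congr 2
      ext P
      simp only [Set.mem_image, Finset.coe_filter, Finset.mem_univ, true_and, Set.mem_ofPred_eq,
        hO, hPt]
      constructor
      · rintro ⟨x, ⟨⟨hx0, hx⟩, hxu⟩, rfl⟩
        obtain ⟨i, rfl⟩ := hprim x hx0
        rw [hcα, ZMod.natCast_eq_natCast_iff] at hxu
        exact ⟨⟨i, hxu, rfl⟩, by simpa using hx⟩
      · rintro ⟨⟨i, hi, rfl⟩, hle⟩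
        refine ⟨α ^ i, ⟨⟨pow_ne_zero _ hα, by simpa using hle⟩, ?_⟩, rfl⟩
        rw [hcα, ZMod.natCast_eq_natCast_iff]
        exact hi
    · simp
    · intro k hk x hx
      simp only [Finset.mem_filter, Finset.mem_univ, true_and] at hx ⊢
      refine ⟨⟨smul_ne_zero hk hx.1.1, ℓ0.smul_mem k hx.1.2⟩, ?_⟩
      rw [Algebra.smul_def, hc _ _ (by simpa using hk) hx.1.1, hcK k hk, zero_add, hx.2]
  set W : ZMod t → ℕ := fun a => w a.val with hW
  have hNW : ∀ a, N a = r * W a := by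
    intro a
    rw [hW, ← hwN, ZMod.natCast_zmod_val]
  have hWw : ∀ u : ℕ, W u = w u := fun u =>
    Nat.eq_of_mul_eq_mul_left hr ((hNW u).symm.trans (hwN u))
  have hinv' : ∀ x : F, x ≠ 0 → (x ^ p ∈ ℓ0 ↔ x ∈ ℓ0) := by
    intro x hx
    obtain ⟨i, rfl⟩ := hprim x hx
    rw [hinv i, ← pow_mul]
    conv_lhs => rw [← Nat.mod_add_div (i * p) v, pow_add, pow_mul, mul_comm]
    exact ℓ0.smul_mem_iff (x := α ^ (i * p % v)) (s := (⟨α ^ v, hαv⟩ : Fq) ^ (i * p / v))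
      (pow_ne_zero _ fun h => pow_ne_zero v hα (congrArg Subtype.val h))
  have hcp : ∀ x : F, x ≠ 0 → c (x ^ p) = p * c x := by
    intro x hx
    obtain ⟨i, rfl⟩ := hprim x hx
    rw [← pow_mul, hcα, hcα, Nat.cast_mul, mul_comm]
  have hfrob : Function.Bijective fun x : F => x ^ p := by
    have hchar : CharP F p := by
      have : Fact p.Prime := ⟨hp⟩
      refine charP_of_card_eq_prime_pow (f := h * 3) ?_
      rw [← Nat.card_eq_fintype_card, hcard, hq, pow_mul]
    have : Fact p.Prime := ⟨hp⟩
    exact Finite.injective_iff_bijective.mp (frobenius_inj F p)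
  have hNp : ∀ a, N (p * a) = N a := by
    intro a
    symm
    refine Finset.card_bijective _ hfrob fun x => ?_
    simp only [Finset.mem_filter, Finset.mem_univ, true_and]
    by_cases hx : x = 0
    · simp [hx, hp.ne_zero]
    · rw [hinv' x hx, hcp x hx, mul_right_inj' hpt]
      simp [hx]
  have hWp : ∀ a, W (p * a) = W a := fun a =>
    Nat.eq_of_mul_eq_mul_left hr (by rw [← hNW, ← hNW, hNp])
  have hsum : ∑ a, W a = r + 2 := by
    have h : ∑ a, N a = (r + 1) ^ 2 - 1 := by
      rw [← hcardq, ← hline, ← card_nonzero_mem ℓ0,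
        Finset.card_eq_sum_card_fiberwise (f := c) (t := Finset.univ) (by simp)]
      simp only [hN, Finset.filter_filter]
    simp only [hNW, ← Finset.mul_sum] at h
    have h2 : (r + 1) ^ 2 = r * (r + 2) + 1 := by ring
    rw [h2, Nat.add_sub_cancel] at h
    exact Nat.eq_of_mul_eq_mul_left hr h
  have hker : (Finset.univ.filter fun z : F => z ≠ 0 ∧ c z = 0).card = r * d := by
    have h := card_mul_card_fiber_zero c hc hcsurj
    rw [ZMod.card, hcard, hcubic, hdt] at h
    exact Nat.eq_of_mul_eq_mul_left ht.pos (h.trans (by ring))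
  have hsq : ∑ a, W a ^ 2 = r + 1 + d := by
    have h := sum_sq_card_fiber hrank hline c hc hcK
    change ∑ a, N a ^ 2 + _ = _ at h
    have h2 : (r + 1) ^ 2 = r * (r + 2) + 1 := by ring
    simp only [hNW, mul_pow, ← Finset.mul_sum] at h
    rw [hker, hcardq, h2, Nat.add_sub_cancel, Nat.add_sub_cancel] at h
    refine Nat.eq_of_mul_eq_mul_left (pow_pos hr 2) ?_
    linarith
  have h1 := sum_orbit_representatives ht hpt I hIrange hIrep W hWp
  have h2 := sum_orbit_representatives ht hpt I hIrange hIrep (fun a => W a ^ 2)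
    fun a => by simp only [hWp]
  rw [← Finset.add_sum_erase _ _ (Finset.mem_univ 0)] at hsum hsq
  have hW0 : W 0 = w 0 := by simpa using hWw 0
  simp only [hWw, hIcard] at h1 h2
  rw [hW0] at hsum hsq
  rw [h1, h2, ← mul_add, ← mul_add, hsum, hsq]
  refine ⟨rfl, ?_⟩
  rw [mul_left_comm]
  congr 1
  linarith
end

section
/- In the Singer model of PG(2,q) with q = p^h (p prime), assume 3 divides q²+q+1 and take t = 3, d = (q²+q+1)/3, with ℓ_0 a line invariant under τ : P_i ↦ P_{(ip) mod (q²+q+1)} and w_u = |ℓ_0 ∩ O_u| for u = 0,1,2. Let i_0, i_1, i_2 be the permutation of {0,1,2} with w_{i_0} ≤ w_{i_1} ≤ w_{i_2}, and set (as real numbers) A = (q−√q+1)/3, B = (q+√q+1)/3, C = (q−2√q+1)/3, D = (q+2√q+1)/3. Then: (i) if q is a non-square, or q = p^{2m} with p ≡ 1 (mod 3), then w_{i_0} < A, A < w_{i_1} < B, and w_{i_2} > B; (ii) if q = p^{4m+2} with p ≡ 2 (mod 3), then w_{i_0} = w_{i_1} = A and w_{i_2} = D (and these are integers, with √q ≡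 2 (mod 3)); (iii) if q = p^{4m} with p ≡ 2 (mod 3), then w_{i_0} = C and w_{i_1} = w_{i_2} = B (and these are integers, with √q ≡ 1 (mod 3)). -/
theorem Nat.Prime.not_dvd_choose_mul_of_three_mul_add_one_eq_pow {p r j : ℕ} (hp : p.Prime)
    (hr : p = 3 * r + 1) (hj : j * r < p) (hj0 : j ≠ 0) :
    ∀ {h k : ℕ}, 3 * k + 1 = p ^ h → ¬ p ∣ (j * k).choose k := by
  intro h
  induction h with
  | zero =>
    intro k hk
    obtain rfl : k = 0 := by simpa using hk
    simpa using hp.one_lt.ne'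
  | succ h ih =>
    intro k' hk'
    obtain ⟨k, hk⟩ : ∃ k, 3 * k + 1 = p ^ h := by
      have h1 : p ^ h % 3 = 1 := by
        rw [Nat.pow_mod, hr]; simp
      exact ⟨p ^ h / 3, by omega⟩
    have hk'' : k' = p * k + r := by
      rw [pow_succ, ← hk] at hk'
      nlinarith
    have := Fact.mk hp
    have hrp : r < p := by omega
    have hjk : j * k' = p * (j * k) + j * r := by rw [hk'']; ring
    have key := Choose.choose_modEq_choose_mod_mul_choose_div_nat (n := j * k') (k := k') (p := p)
    rw [hjk, hk'', Nat.mul_add_mod, Nat.mul_add_mod, Nat.mod_eq_of_lt hj, Nat.mod_eq_of_lt hrp,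
      Nat.mul_add_div hp.pos, Nat.mul_add_div hp.pos, Nat.div_eq_of_lt hj, Nat.div_eq_of_lt hrp,
      add_zero, add_zero] at key
    rw [hjk, hk'', (key.dvd_iff dvd_rfl), hp.dvd_mul]
    rintro (hd | hd)
    · have hle : r ≤ j * r := Nat.le_mul_of_pos_left r (Nat.pos_of_ne_zero hj0)
      have h1 : p ∣ (j * r).factorial := by
        rw [← Nat.choose_mul_factorial_mul_factorial hle, mul_assoc]
        exact hd.mul_right _
      exact absurd (hp.dvd_factorial.1 h1) (by omega)
    · exact ih hk hd

/-- A number below `q³` written in base `q` with digits `a, b, c` is determined by its digits. -/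
theorem Nat.eq_of_three_digits_eq {q a b c k : ℕ} (ha : a < q) (hb : b < q) (hk : k < q)
    (h : a + b * q + c * q ^ 2 = k + k * q + k * q ^ 2) : a = k ∧ b = k := by
  have hq : 0 < q := by omega
  have h1 : a + q * (b + q * c) = k + q * (k + q * k) := by linarith
  have h2 := congrArg (· % q) h1
  simp only [Nat.add_mul_mod_self_left, Nat.mod_eq_of_lt ha, Nat.mod_eq_of_lt hk] at h2
  subst h2
  have h3 := Nat.eq_of_mul_eq_mul_left hq (Nat.add_left_cancel h1)
  have h4 := congrArg (· % q) h3
  simp only [Nat.add_mul_mod_self_left, Nat.mod_eq_of_lt ha, Nat.mod_eq_of_lt hb] at h4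
  exact ⟨rfl, h4⟩

theorem FiniteField.sum_pow_eq_ite {F : Type*} [Field F] [Fintype F] {i : ℕ} (hi : i ≠ 0) :
    ∑ x : F, x ^ i = if Fintype.card F - 1 ∣ i then -1 else 0 := by
  classical
  rw [← FiniteField.sum_pow_units, ← Finset.sum_subset (Finset.subset_univ
    (Finset.univ.erase (0 : F)))]
  · refine (Finset.sum_bij (fun (u : Fˣ) _ => (u : F)) ?_ ?_ ?_ ?_).symm
    · simp
    · intro a _ b _ hab; exact Units.ext hab
    · intro b hb; exact ⟨Units.mk0 b (by simpa using hb), by simp, rfl⟩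
    · simp
  · intro x _ hx
    have : x = 0 := by simpa using hx
    rw [this, zero_pow hi]

/-- With `q = 3k + 1`, the only monomial of `x^(2(q³-1)/3) (x + x^q + x^(q²))^(q-1)` whose sum over
the field with `q³` elements does not vanish is the one with all three exponents equal to `k`. -/
theorem FiniteField.sum_pow_mul_trace_pow {F : Type*} [Field F] [Fintype F] {q k : ℕ}
    (hk : q = 3 * k + 1) (hk0 : 0 < k) (hcard : Fintype.card F = q ^ 3) :
    ∑ x : F, x ^ (2 * (k * (q ^ 2 + q + 1))) * (x + (x ^ q + x ^ q ^ 2)) ^ (q - 1) =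
      -(((3 * k).choose k * (2 * k).choose k : ℕ) : F) := by
  have hq1 : q - 1 = 3 * k := by omega
  have hdvd : ∀ a ∈ Finset.range (3 * k + 1), ∀ b ∈ Finset.range (3 * k - a + 1),
      (q ^ 3 - 1 ∣ 2 * (k * (q ^ 2 + q + 1)) + a + q * b + q ^ 2 * (3 * k - a - b)) ↔
        a = k ∧ b = k := by
    intro a ha b hb
    simp only [Finset.mem_range] at ha hb
    have hc : q ^ 3 - 1 = 3 * (k * (q ^ 2 + q + 1)) := by
      rw [hk]; apply Nat.sub_eq_of_eq_add; ring
    obtain ⟨c, hc3⟩ : ∃ c, a + b + c = 3 * k := ⟨3 * k - a - b, by omega⟩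
    have hcc : 3 * k - a - b = c := by omega
    rw [hcc, hc]
    constructor
    · rintro ⟨m, hm⟩
      have hub : a + q * b + q ^ 2 * c ≤ 3 * (k * (q ^ 2 + q + 1)) := by
        have h1 : q * b ≤ q * (3 * k) := Nat.mul_le_mul_left _ (by omega)
        have h2 : q ^ 2 * c ≤ q ^ 2 * (3 * k) := Nat.mul_le_mul_left _ (by omega)
        nlinarith
      have hpos : 0 < k * (q ^ 2 + q + 1) := by positivity
      have hm1 : m = 1 := by
        have hm2 : m < 2 := by
          by_contra! h
          nlinarith
        have hm0 : m ≠ 0 := by rintro rfl; omega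
        omega
      subst hm1
      refine Nat.eq_of_three_digits_eq (q := q) (c := c) (by omega) (by omega) (by omega) ?_
      nlinarith
    · rintro ⟨ha', hb'⟩
      have hc' : c = k := by omega
      exact ⟨1, by rw [ha', hb', hc']; ring⟩
  have hexp : ∀ x : F,
      x ^ (2 * (k * (q ^ 2 + q + 1))) * (x + (x ^ q + x ^ q ^ 2)) ^ (q - 1) =
      ∑ a ∈ Finset.range (3 * k + 1), ∑ b ∈ Finset.range (3 * k - a + 1),
        (((3 * k).choose a * (3 * k - a).choose b : ℕ) : F) *
          x ^ (2 * (k * (q ^ 2 + q + 1)) + a + q * b + q ^ 2 * (3 * k - a - b)) := by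
    intro x
    rw [hq1, add_pow, Finset.mul_sum]
    refine Finset.sum_congr rfl fun a _ => ?_
    rw [add_pow, Finset.mul_sum, Finset.sum_mul, Finset.mul_sum]
    refine Finset.sum_congr rfl fun b _ => ?_
    push_cast
    rw [pow_add, pow_add, pow_add, pow_mul x q, pow_mul x (q ^ 2)]
    ring
  have hE : 2 * (k * (q ^ 2 + q + 1)) ≠ 0 := by positivity
  rw [Finset.sum_congr rfl fun x _ => hexp x, Finset.sum_comm]
  simp_rw [Finset.sum_comm (s := Finset.univ), ← Finset.mul_sum]
  rw [Finset.sum_eq_single_of_mem k (by simp; omega), Finset.sum_eq_single_of_mem k (by simp; omega)]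
  · rw [FiniteField.sum_pow_eq_ite (by omega), hcard,
      if_pos ((hdvd k (by simp; omega) k (by simp; omega)).2 ⟨rfl, rfl⟩),
      show 3 * k - k = 2 * k by omega]
    ring
  · intro b hb hbk
    rw [FiniteField.sum_pow_eq_ite (by omega), hcard, if_neg, mul_zero]
    rw [hdvd k (by simp; omega) b hb]
    tauto
  · intro a ha hak
    refine Finset.sum_eq_zero fun b hb => ?_
    rw [FiniteField.sum_pow_eq_ite (by omega), hcard, if_neg, mul_zero]
    rw [hdvd a ha b hb]
    tauto

open scoped Classical in
theorem FiniteField.sum_trace_eq_zero_pow {K F : Type*} [Field K] [Field F] [Fintype F]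
    [Algebra K F] {q k : ℕ} (hcardK : Nat.card K = q)
    (hrank : Module.finrank K F = 3) (hk : q = 3 * k + 1) (hk0 : 0 < k) :
    ∑ x : F with Algebra.trace K F x = 0, x ^ (2 * (k * (q ^ 2 + q + 1))) =
      (((3 * k).choose k * (2 * k).choose k : ℕ) : F) := by
  have := Finite.of_injective _ (FaithfulSMul.algebraMap_injective K F)
  have := Fintype.ofFinite K
  have hcK : Fintype.card K = q := by rw [← hcardK, Nat.card_eq_fintype_card]
  have hcard : Fintype.card F = q ^ 3 := by
    rw [Module.card_eq_pow_finrank (K := K), hrank, hcK]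
  have hE : 2 * (k * (q ^ 2 + q + 1)) ≠ 0 := by positivity
  have hind : ∀ x : F, (if Algebra.trace K F x = 0 then x ^ (2 * (k * (q ^ 2 + q + 1))) else 0) =
      x ^ (2 * (k * (q ^ 2 + q + 1))) -
        x ^ (2 * (k * (q ^ 2 + q + 1))) * (x + (x ^ q + x ^ q ^ 2)) ^ (q - 1) := by
    intro x
    have htr : algebraMap K F (Algebra.trace K F x) = x + (x ^ q + x ^ q ^ 2) := by
      rw [FiniteField.algebraMap_trace_eq_sum_pow, hrank, hcardK]
      simp [Finset.sum_range_succ, add_assoc]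
    rw [← htr]
    split_ifs with h
    · rw [h, map_zero, zero_pow (by omega), mul_zero, sub_zero]
    · rw [← map_pow, ← hcK, FiniteField.pow_card_sub_one_eq_one _ h, map_one, mul_one, sub_self]
  rw [Finset.sum_filter, Finset.sum_congr rfl fun x _ => hind x, Finset.sum_sub_distrib,
    FiniteField.sum_pow_mul_trace_pow hk hk0 hcard, FiniteField.sum_pow_eq_ite hE, if_neg]
  · ring
  · have hc : q ^ 3 - 1 = 3 * (k * (q ^ 2 + q + 1)) := by
      rw [hk]; apply Nat.sub_eq_of_eq_add; ring
    rw [hcard, hc]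
    intro h
    have := Nat.le_of_dvd (by omega) h
    omega

theorem Submodule.exists_mem_iff_trace_mul_eq_zero {K F : Type*} [Field K] [Field F]
    [Algebra K F] [FiniteDimensional K F] [Algebra.IsSeparable K F]
    (ℓ : Submodule K F) (h : Module.finrank K ℓ + 1 = Module.finrank K F) :
    ∃ c : F, c ≠ 0 ∧ ∀ x, x ∈ ℓ ↔ Algebra.trace K F (c * x) = 0 := by
  have hlt : ℓ < ⊤ := by
    rw [lt_top_iff_ne_top]
    rintro rfl
    rw [finrank_top] at h
    omega
  obtain ⟨f, hf0, hf⟩ := Submodule.exists_le_ker_of_lt_top ℓ hlt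
  have hker := Module.Dual.finrank_ker_add_one_of_ne_zero hf0
  have hℓ : ℓ = LinearMap.ker f := Submodule.eq_of_le_of_finrank_eq hf (by omega)
  obtain ⟨c, hc⟩ := ((Algebra.traceForm K F).toDual (traceForm_nondegenerate K F)).surjective f
  have hcx : ∀ x, f x = Algebra.trace K F (c * x) := by
    intro x
    rw [← hc, LinearMap.BilinForm.toDual_def, Algebra.traceForm_apply]
  refine ⟨c, ?_, fun x => ?_⟩
  · rintro rfl
    exact hf0 (LinearMap.ext fun x => by simp [hcx])
  · rw [hℓ, LinearMap.mem_ker, hcx]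

open scoped Classical in
theorem Submodule.sum_pow_ne_zero_of_finrank_eq_two {K F : Type*} [Field K] [Field F] [Fintype F]
    [Algebra K F] {p r h k : ℕ} (hp : p.Prime) (hr : p = 3 * r + 1) [CharP F p]
    (hcardK : Nat.card K = p ^ h) (hrank : Module.finrank K F = 3)
    (hk : 3 * k + 1 = p ^ h) (hk0 : 0 < k) (ℓ : Submodule K F) (hℓ : Module.finrank K ℓ = 2) :
    ∑ x : F with x ∈ ℓ, x ^ (2 * (k * ((p ^ h) ^ 2 + p ^ h + 1))) ≠ 0 := by
  have := Finite.of_injective _ (FaithfulSMul.algebraMap_injective K F)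
  obtain ⟨c, hc0, hc⟩ := ℓ.exists_mem_iff_trace_mul_eq_zero (by omega)
  have hsum := FiniteField.sum_trace_eq_zero_pow (F := F) hcardK hrank hk.symm hk0
  intro h0
  have hz : ∑ x : F with Algebra.trace K F x = 0, x ^ (2 * (k * ((p ^ h) ^ 2 + p ^ h + 1))) =
      c ^ (2 * (k * ((p ^ h) ^ 2 + p ^ h + 1))) *
        ∑ x : F with x ∈ ℓ, x ^ (2 * (k * ((p ^ h) ^ 2 + p ^ h + 1))) := by
    rw [Finset.mul_sum]
    refine (Finset.sum_bij (fun x _ => c * x) ?_ ?_ ?_ ?_).symm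
    · simp [hc]
    · intro a _ b _ hab; exact mul_left_cancel₀ hc0 hab
    · intro b hb
      refine ⟨c⁻¹ * b, ?_, mul_inv_cancel_left₀ hc0 b⟩
      simpa [hc, mul_inv_cancel_left₀ hc0] using hb
    · intro x _; rw [mul_pow]
  rw [h0, mul_zero, hsum, CharP.cast_eq_zero_iff F p, hp.dvd_mul] at hz
  rcases hz with hz | hz
  · exact hp.not_dvd_choose_mul_of_three_mul_add_one_eq_pow hr (by omega) (by omega) hk hz
  · exact hp.not_dvd_choose_mul_of_three_mul_add_one_eq_pow hr (by omega) (by omega) hk hz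

/-- The multipliers of a proper nonzero subspace of an extension of prime degree are scalars. -/
theorem Submodule.mem_range_algebraMap_of_mul_mem {K F : Type*} [Field K] [Field F] [Algebra K F]
    (hrank : (Module.finrank K F).Prime) {ℓ : Submodule K F} (hbot : ℓ ≠ ⊥) (htop : ℓ ≠ ⊤) {m : F}
    (hm : ∀ x ∈ ℓ, m * x ∈ ℓ) : m ∈ Set.range (algebraMap K F) := by
  let S : Subalgebra K F :=
    { carrier := {m | ∀ x ∈ ℓ, m * x ∈ ℓ}
      mul_mem' := fun {a b} ha hb x hx => by rw [mul_assoc]; exact ha _ (hb _ hx)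
      add_mem' := fun {a b} ha hb x hx => by rw [add_mul]; exact ℓ.add_mem (ha _ hx) (hb _ hx)
      algebraMap_mem' := fun r x hx => by
        rw [← Algebra.smul_def]; exact ℓ.smul_mem r hx }
  have := Subalgebra.isSimpleOrder_of_finrank_prime K F hrank
  rcases eq_bot_or_eq_top S with hS | hS
  · have hmS : m ∈ S := hm
    rwa [hS, Algebra.mem_bot] at hmS
  · refine absurd ?_ htop
    obtain ⟨y, hy, hy0⟩ := ℓ.ne_bot_iff.1 hbot
    rw [eq_top_iff]
    intro x _
    have hxS : x * y⁻¹ ∈ S := by rw [hS]; exact Algebra.mem_top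
    simpa [hy0] using hxS y hy

/-- A line of the Singer plane meets each of its other translates in one point. -/
theorem Submodule.finrank_inf_comap_mul {K F : Type*} [Field K] [Field F] [Algebra K F]
    (hrank : Module.finrank K F = 3) {ℓ : Submodule K F} (hℓ : Module.finrank K ℓ = 2) {m : F}
    (hm0 : m ≠ 0) (hm : m ∉ Set.range (algebraMap K F)) :
    Module.finrank K ↥(ℓ ⊓ ℓ.comap (LinearMap.mulLeft K m)) = 1 := by
  have : FiniteDimensional K F := FiniteDimensional.of_finrank_pos (by omega)
  have hcomap : Module.finrank K (ℓ.comap (LinearMap.mulLeft K m)) = 2 := by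
    let e : F ≃ₗ[K] F := LinearEquiv.ofBijective (LinearMap.mulLeft K m)
      ⟨mul_right_injective₀ hm0, fun y => ⟨m⁻¹ * y, by simp [hm0]⟩⟩
    have h1 : ℓ.comap (LinearMap.mulLeft K m) = ℓ.map (e.symm : F →ₗ[K] F) := by
      rw [← Submodule.comap_equiv_eq_map_symm]; rfl
    rw [h1, LinearEquiv.finrank_map_eq, hℓ]
  have hsum := Submodule.finrank_sup_add_finrank_inf_eq ℓ (ℓ.comap (LinearMap.mulLeft K m))
  have hsup := Submodule.finrank_le (ℓ ⊔ ℓ.comap (LinearMap.mulLeft K m))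
  have hinf := Submodule.finrank_mono (inf_le_left : ℓ ⊓ ℓ.comap (LinearMap.mulLeft K m) ≤ ℓ)
  have hne : Module.finrank K ↥(ℓ ⊓ ℓ.comap (LinearMap.mulLeft K m)) ≠ 2 := by
    intro h2
    have heq := Submodule.eq_of_le_of_finrank_eq
      (inf_le_left : ℓ ⊓ ℓ.comap (LinearMap.mulLeft K m) ≤ ℓ) (by omega)
    refine hm (Submodule.mem_range_algebraMap_of_mul_mem (by rw [hrank]; exact Nat.prime_three)
      (ℓ := ℓ) ?_ ?_ fun x hx => ?_)
    · rintro rfl; simp at hℓ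
    · rintro rfl; rw [finrank_top] at hℓ; omega
    · rw [← heq] at hx; exact hx.2
  omega

open scoped Classical in
theorem Submodule.card_filter_mem_ne_zero {K F : Type*} [Field K] [Field F] [Algebra K F]
    [Fintype F] (ℓ : Submodule K F) :
    (Finset.univ.filter fun x : F => x ∈ ℓ ∧ x ≠ 0).card =
      Nat.card K ^ Module.finrank K ℓ - 1 := by
  have := Finite.of_injective _ (FaithfulSMul.algebraMap_injective K F)
  have h1 : (Finset.univ.filter fun x : F => x ∈ ℓ ∧ x ≠ 0) =
      (Finset.univ.filter fun x : F => x ∈ ℓ).erase 0 := by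
    ext x; simp [and_comm]
  rw [h1, Finset.card_erase_of_mem (by simp), ← Module.natCard_eq_pow_finrank,
    Nat.card_eq_fintype_card, Fintype.card_subtype]

open scoped Classical in
theorem FiniteField.card_filter_pow_eq_one {F : Type*} [Field F] [Fintype F] {E : ℕ} (hE : E ≠ 0)
    (hdvd : E ∣ Fintype.card F - 1) : (Finset.univ.filter fun x : F => x ^ E = 1).card = E := by
  have h := IsCyclic.card_powMonoidHom_ker Fˣ E
  rw [Nat.card_units, Nat.card_eq_fintype_card (α := F), Nat.gcd_eq_right hdvd] at h
  refine Eq.trans ?_ h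
  rw [Nat.card_eq_fintype_card, ← Finset.card_univ]
  symm
  refine Finset.card_bij (fun u _ => ((u : Fˣ) : F)) ?_ ?_ ?_
  · rintro ⟨u, hu⟩ _
    have : u ^ E = 1 := hu
    simp [← Units.val_pow_eq_pow_val, this]
  · intro a _ b _ hab
    exact Subtype.ext (Units.ext hab)
  · intro x hx
    have hx1 : x ^ E = 1 := by simpa using hx
    have hx0 : x ≠ 0 := by rintro rfl; rw [zero_pow hE] at hx1; exact zero_ne_one hx1
    exact ⟨⟨Units.mk0 x hx0, by rw [MonoidHom.mem_ker]; ext; simpa using hx1⟩,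
      Finset.mem_univ _, rfl⟩

open scoped Classical in
/-- The number of pairs of nonzero vectors on a line lying in the same coset of the group of
`E`-th roots of unity. -/
theorem Submodule.card_pairs_pow_eq {K F : Type*} [Field K] [Field F] [Algebra K F] [Fintype F]
    {q E : ℕ} (hcardK : Nat.card K = q) (hrank : Module.finrank K F = 3) {ℓ : Submodule K F}
    (hℓ : Module.finrank K ℓ = 2) (hE0 : E ≠ 0) (hE : E ∣ q ^ 3 - 1) (hqE : q - 1 ∣ E) :
    (Finset.univ.filter fun x : F × F => (x.1 ∈ ℓ ∧ x.1 ≠ 0) ∧ (x.2 ∈ ℓ ∧ x.2 ≠ 0) ∧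
      x.1 ^ E = x.2 ^ E).card = (q - 1) * (q ^ 2 - 1) + (E - (q - 1)) * (q - 1) := by
  have := Finite.of_injective _ (FaithfulSMul.algebraMap_injective K F)
  have := Fintype.ofFinite K
  have hcK : Fintype.card K = q := by rw [← hcardK, Nat.card_eq_fintype_card]
  have hcard : Fintype.card F = q ^ 3 := by
    rw [Module.card_eq_pow_finrank (K := K), hrank, hcK]
  have hsigma : (Finset.univ.filter fun x : F × F => (x.1 ∈ ℓ ∧ x.1 ≠ 0) ∧
      (x.2 ∈ ℓ ∧ x.2 ≠ 0) ∧ x.1 ^ E = x.2 ^ E).card =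
      ((Finset.univ.filter fun m : F => m ^ E = 1).sigma fun m =>
        Finset.univ.filter fun y : F => y ∈ ℓ ⊓ ℓ.comap (LinearMap.mulLeft K m) ∧ y ≠ 0).card := by
    refine Finset.card_bij' (fun x _ => ⟨x.1 / x.2, x.2⟩) (fun s _ => (s.1 * s.2, s.2)) ?_ ?_ ?_ ?_
    · rintro ⟨x, y⟩ h
      simp only [Finset.mem_filter, Finset.mem_univ, true_and] at h
      obtain ⟨⟨hx, hx0⟩, ⟨hy, hy0⟩, hxy⟩ := h
      simp [div_pow, hxy, hy0, hx, hy]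
    · rintro ⟨m, y⟩ h
      simp only [Finset.mem_sigma, Finset.mem_filter, Finset.mem_univ, true_and,
        Submodule.mem_inf, Submodule.mem_comap, LinearMap.mulLeft_apply] at h
      obtain ⟨hm, ⟨hy, hmy⟩, hy0⟩ := h
      have hm0 : m ≠ 0 := by rintro rfl; rw [zero_pow hE0] at hm; exact zero_ne_one hm
      simp [mul_pow, hm, hy, hmy, hy0, hm0]
    · rintro ⟨x, y⟩ h
      simp only [Finset.mem_filter, Finset.mem_univ, true_and] at h
      simp [h.2.1.2]
    · rintro ⟨m, y⟩ h
      simp only [Finset.mem_sigma, Finset.mem_filter, Finset.mem_univ, true_and] at h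
      simp [h.2.2]
  have hfilter : ((Finset.univ.filter fun m : F => m ^ E = 1).filter
      fun m => m ∈ Set.range (algebraMap K F)).card = q - 1 := by
    rw [← hcK, ← Fintype.card_units, ← Finset.card_univ]
    symm
    refine Finset.card_bij (fun u _ => algebraMap K F (u : K)) ?_ ?_ ?_
    · intro u _
      obtain ⟨n, rfl⟩ := hqE
      have hu : (u : K) ^ (q - 1) = 1 := by
        rw [← hcK]; exact FiniteField.pow_card_sub_one_eq_one _ u.ne_zero
      simp [← map_pow, pow_mul, hu]
    · intro a _ b _ hab
      exact Units.ext ((algebraMap K F).injective hab)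
    · intro m hm
      simp only [Finset.mem_filter, Finset.mem_univ, true_and] at hm
      obtain ⟨hm1, a, rfl⟩ := hm
      have ha : a ≠ 0 := by
        rintro rfl; rw [map_zero, zero_pow hE0] at hm1; exact zero_ne_one hm1
      exact ⟨Units.mk0 a ha, Finset.mem_univ _, rfl⟩
  have hnot : ((Finset.univ.filter fun m : F => m ^ E = 1).filter
      fun m => m ∉ Set.range (algebraMap K F)).card = E - (q - 1) := by
    have h1 := Finset.card_filter_add_card_filter_not (s := Finset.univ.filter fun m : F => m ^ E = 1)
      (fun m => m ∈ Set.range (algebraMap K F))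
    rw [FiniteField.card_filter_pow_eq_one hE0 (by rwa [hcard]), hfilter] at h1
    omega
  rw [hsigma, Finset.card_sigma, ← Finset.sum_filter_add_sum_filter_not _
    (fun m => m ∈ Set.range (algebraMap K F))]
  congr 1
  · rw [← hfilter, ← smul_eq_mul, ← Finset.sum_const]
    refine Finset.sum_congr rfl fun m hm => ?_
    obtain ⟨-, a, rfl⟩ := by simpa using hm
    rw [Submodule.card_filter_mem_ne_zero, inf_eq_left.2, hℓ, hcardK]
    intro x hx
    rw [Submodule.mem_comap, LinearMap.mulLeft_apply, ← Algebra.smul_def]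
    exact ℓ.smul_mem a hx
  · rw [← hnot, ← smul_eq_mul, ← Finset.sum_const]
    refine Finset.sum_congr rfl fun m hm => ?_
    simp only [Finset.mem_filter, Finset.mem_univ, true_and] at hm
    have hm0 : m ≠ 0 := by
      rintro rfl; rw [zero_pow hE0] at hm; exact zero_ne_one hm.1
    rw [Submodule.card_filter_mem_ne_zero,
      Submodule.finrank_inf_comap_mul hrank hℓ hm0 hm.2, hcardK, pow_one]

open scoped Classical in
/-- A scaling-invariant set of nonzero vectors has `q - 1` vectors in each of its points. -/
theorem Finset.card_eq_mul_card_image_span {K F : Type*} [Field K] [Field F] [Algebra K F]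
    [Fintype F] (S : Finset F) (h0 : 0 ∉ S) (hS : ∀ (c : Kˣ), ∀ x ∈ S, (c : K) • x ∈ S) :
    S.card = (Nat.card K - 1) * (S.image fun x => Submodule.span K {x}).card := by
  have := Finite.of_injective _ (FaithfulSMul.algebraMap_injective K F)
  have := Fintype.ofFinite K
  rw [Finset.card_eq_sum_card_image (fun x => Submodule.span K {x}) S, mul_comm, ← smul_eq_mul,
    ← Finset.sum_const]
  refine Finset.sum_congr rfl fun P hP => ?_
  obtain ⟨a, ha, rfl⟩ := Finset.mem_image.1 hP
  have ha0 : a ≠ 0 := fun h => h0 (h ▸ ha)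
  rw [← Nat.card_units, Nat.card_eq_fintype_card, ← Finset.card_univ]
  symm
  refine Finset.card_bij (fun c _ => (c : K) • a) ?_ ?_ ?_
  · intro c _
    rw [Finset.mem_filter]
    exact ⟨hS c a ha, (Submodule.span_singleton_eq_span_singleton.2 ⟨c, rfl⟩).symm⟩
  · intro c _ d _ hcd
    exact Units.ext (smul_left_injective K ha0 hcd)
  · intro x hx
    obtain ⟨c, hc⟩ := Submodule.span_singleton_eq_span_singleton.1 (Finset.mem_filter.1 hx).2.symm
    exact ⟨c, Finset.mem_univ _, hc⟩

open scoped Classical in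
/-- Summing over the vectors of `S`, grouped by the value of `x ^ E` among the cube roots of
unity. -/
theorem Finset.sum_range_three_card_filter_pow_eq {F M : Type*} [Field F] [Fintype F]
    [AddCommMonoid M] {E : ℕ} {ζ : F} (hζ : IsPrimitiveRoot ζ 3)
    (hE : 3 * E = Fintype.card F - 1) (S : Finset F) (h0 : 0 ∉ S) (f : F → M) :
    ∑ u ∈ Finset.range 3, (S.filter fun x => x ^ E = ζ ^ u).card • f (ζ ^ u) =
      ∑ x ∈ S, f (x ^ E) := by
  have hmaps : ∀ x ∈ S, x ^ E ∈ (Finset.range 3).image (fun u => ζ ^ u) := by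
    intro x hx
    have hx0 : x ≠ 0 := fun h => h0 (h ▸ hx)
    have h1 : (x ^ E) ^ 3 = 1 := by
      rw [← pow_mul, mul_comm, hE, FiniteField.pow_card_sub_one_eq_one x hx0]
    obtain ⟨i, hi, hi'⟩ := hζ.eq_pow_of_pow_eq_one h1
    exact Finset.mem_image.2 ⟨i, by simpa using hi, hi'⟩
  rw [← Finset.sum_fiberwise_of_maps_to hmaps, Finset.sum_image]
  · refine Finset.sum_congr rfl fun u _ => ?_
    rw [Finset.sum_congr rfl fun x hx => by rw [(Finset.mem_filter.1 hx).2], Finset.sum_const]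
  · intro i hi j hj hij
    exact hζ.pow_inj (by simpa using hi) (by simpa using hj) hij

open scoped Classical in
/-- First and second moments of the intersection numbers of a line with the three orbits. -/
theorem Submodule.sum_orbit_counts {K F : Type*} [Field K] [Field F] [Algebra K F] [Fintype F]
    {q k : ℕ} (hcardK : Nat.card K = q) (hrank : Module.finrank K F = 3)
    (hk : q = 3 * k + 1) (hk0 : 0 < k) {ℓ : Submodule K F} (hℓ : Module.finrank K ℓ = 2)
    {ζ : F} (hζ : IsPrimitiveRoot ζ 3) (w : ℕ → ℕ)
    (hw : ∀ u < 3, (Finset.univ.filter fun x : F => x ∈ ℓ ∧ x ^ (k * (q ^ 2 + q + 1)) = ζ ^ u).card =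
      (q - 1) * w u) :
    w 0 + w 1 + w 2 = q + 1 ∧ 3 * (w 0 ^ 2 + w 1 ^ 2 + w 2 ^ 2) = q ^ 2 + 4 * q + 1 := by
  have := Finite.of_injective _ (FaithfulSMul.algebraMap_injective K F)
  have := Fintype.ofFinite K
  have hcK : Fintype.card K = q := by rw [← hcardK, Nat.card_eq_fintype_card]
  have hcard : Fintype.card F = q ^ 3 := by
    rw [Module.card_eq_pow_finrank (K := K), hrank, hcK]
  have hc : q ^ 3 - 1 = 3 * (k * (q ^ 2 + q + 1)) := by
    rw [hk]; apply Nat.sub_eq_of_eq_add; ring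
  set E := k * (q ^ 2 + q + 1) with hEdef
  have hE0 : E ≠ 0 := by positivity
  set S := Finset.univ.filter fun x : F => x ∈ ℓ ∧ x ≠ 0 with hS
  have hS0 : (0 : F) ∉ S := by simp [hS]
  have hSf : ∀ u < 3, (S.filter fun x => x ^ E = ζ ^ u).card = (q - 1) * w u := by
    intro u hu
    rw [← hw u hu]
    congr 1
    ext x
    simp only [hS, Finset.mem_filter, Finset.mem_univ, true_and]
    refine ⟨fun h => ⟨h.1.1, h.2⟩, fun h => ⟨⟨h.1, ?_⟩, h.2⟩⟩
    rintro rfl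
    rw [zero_pow hE0] at h
    exact pow_ne_zero u (hζ.ne_zero (by norm_num)) h.2.symm
  have hcardS : S.card = q ^ 2 - 1 := by
    rw [hS, Submodule.card_filter_mem_ne_zero, hcardK, hℓ]
  have h1 := Finset.sum_range_three_card_filter_pow_eq hζ (by rw [hcard, hc]) S hS0
    (fun _ => (1 : ℕ))
  have h2 := Finset.sum_range_three_card_filter_pow_eq hζ (by rw [hcard, hc]) S hS0
    (fun z => (S.filter fun y => y ^ E = z).card)
  have h3 : ∑ x ∈ S, (S.filter fun y => y ^ E = x ^ E).card =
      (q - 1) * (q ^ 2 - 1) + (E - (q - 1)) * (q - 1) := by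
    rw [← Submodule.card_pairs_pow_eq hcardK hrank hℓ hE0 (by rw [hc]; exact Dvd.intro_left _ rfl)
      ?_]
    · rw [← Finset.card_sigma]
      refine Finset.card_bij' (fun s _ => (s.1, s.2)) (fun x _ => ⟨x.1, x.2⟩) ?_ ?_ ?_ ?_
      · rintro ⟨x, y⟩ h
        simp only [Finset.mem_sigma, Finset.mem_filter, hS, Finset.mem_univ, true_and] at h ⊢
        exact ⟨h.1, h.2.1, h.2.2.symm⟩
      · rintro ⟨x, y⟩ h
        simp only [Finset.mem_sigma, Finset.mem_filter, hS, Finset.mem_univ, true_and] at h ⊢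
        exact ⟨h.1, h.2.1, h.2.2.symm⟩
      · rintro ⟨x, y⟩ _; rfl
      · rintro ⟨x, y⟩ _; rfl
    · refine ⟨3 * k ^ 2 + 3 * k + 1, ?_⟩
      rw [hEdef, hk, Nat.add_sub_cancel]
      ring
  rw [h3] at h2
  simp only [Finset.sum_const, smul_eq_mul, mul_one, hcardS, Finset.sum_range_succ,
    Finset.sum_range_zero, zero_add] at h1 h2
  rw [hSf 0 (by norm_num), hSf 1 (by norm_num), hSf 2 (by norm_num)] at h1 h2
  have hq1 : q - 1 = 3 * k := by omega
  have hq2 : q ^ 2 - 1 = 3 * k * (q + 1) := by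
    rw [hk]; apply Nat.sub_eq_of_eq_add; ring
  have hE1 : E - (q - 1) = 3 * k * (3 * k ^ 2 + 3 * k) := by
    rw [hEdef, hq1, hk]; apply Nat.sub_eq_of_eq_add; ring
  rw [hq1, hq2] at h1
  rw [hE1, hq1, hq2] at h2
  constructor
  · apply Nat.eq_of_mul_eq_mul_left (show 0 < 3 * k by omega)
    linarith
  · have h4 : 3 * k * (3 * k) * (w 0 ^ 2 + w 1 ^ 2 + w 2 ^ 2) =
        3 * k * (3 * k) * (q + 1 + (3 * k ^ 2 + 3 * k)) := by linarith
    rw [Nat.eq_of_mul_eq_mul_left (by positivity) h4, hk]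
    ring

open scoped Classical in
/-- For `p ≡ 1 (mod 3)`, the intersection numbers of a line with the three orbits are not all
congruent modulo `p`. -/
theorem Submodule.orbit_counts_not_congruent {K F : Type*} [Field K] [Field F] [Fintype F]
    [Algebra K F] {p r h q k : ℕ} (hp : p.Prime) (hr : p = 3 * r + 1) [CharP F p]
    (hq : q = p ^ h) (hcardK : Nat.card K = q) (hrank : Module.finrank K F = 3)
    (hk : q = 3 * k + 1) (hk0 : 0 < k) {ℓ : Submodule K F} (hℓ : Module.finrank K ℓ = 2)
    {ζ : F} (hζ : IsPrimitiveRoot ζ 3) (w : ℕ → ℕ)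
    (hw : ∀ u < 3, (Finset.univ.filter fun x : F => x ∈ ℓ ∧ x ^ (k * (q ^ 2 + q + 1)) = ζ ^ u).card =
      (q - 1) * w u) :
    ¬ ((w 0 : F) = w 1 ∧ (w 1 : F) = w 2) := by
  rintro ⟨h01, h12⟩
  have := Finite.of_injective _ (FaithfulSMul.algebraMap_injective K F)
  have := Fintype.ofFinite K
  have hcK : Fintype.card K = q := by rw [← hcardK, Nat.card_eq_fintype_card]
  have hcard : Fintype.card F = q ^ 3 := by
    rw [Module.card_eq_pow_finrank (K := K), hrank, hcK]
  have hc : q ^ 3 - 1 = 3 * (k * (q ^ 2 + q + 1)) := by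
    rw [hk]; apply Nat.sub_eq_of_eq_add; ring
  have hne := ℓ.sum_pow_ne_zero_of_finrank_eq_two hp hr (hcardK.trans hq) hrank
    (hk.symm.trans hq) hk0 hℓ
  rw [← hq] at hne
  set E := k * (q ^ 2 + q + 1) with hEdef
  have hE0 : E ≠ 0 := by positivity
  have hsum := Finset.sum_range_three_card_filter_pow_eq hζ (by rw [hcard, hc])
    (Finset.univ.filter fun x : F => x ∈ ℓ ∧ x ≠ 0) (by simp) (fun z => z ^ 2)
  have hSf : ∀ u < 3, ((Finset.univ.filter fun x : F => x ∈ ℓ ∧ x ≠ 0).filter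
      fun x => x ^ E = ζ ^ u).card = (q - 1) * w u := by
    intro u hu
    rw [← hw u hu]
    congr 1
    ext x
    simp only [Finset.mem_filter, Finset.mem_univ, true_and]
    refine ⟨fun h => ⟨h.1.1, h.2⟩, fun h => ⟨⟨h.1, ?_⟩, h.2⟩⟩
    rintro rfl
    rw [zero_pow hE0] at h
    exact pow_ne_zero u (hζ.ne_zero (by norm_num)) h.2.symm
  have hdrop : ∑ x : F with x ∈ ℓ ∧ x ≠ 0, (x ^ E) ^ 2 = ∑ x : F with x ∈ ℓ, x ^ (2 * E) := by
    rw [← Finset.filter_filter, Finset.sum_filter_of_ne]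
    · simp only [← pow_mul, mul_comm]
    · rintro x - hx rfl
      simp [hE0] at hx
  refine hne ?_
  rw [← hdrop, ← hsum]
  simp only [Finset.sum_range_succ, Finset.sum_range_zero, zero_add]
  rw [hSf 0 (by norm_num), hSf 1 (by norm_num), hSf 2 (by norm_num)]
  have hζ3 : ζ ^ 3 = 1 := hζ.pow_eq_one
  have hζsum : 1 + ζ + ζ ^ 2 = 0 := by
    have := hζ.geom_sum_eq_zero (by norm_num)
    simpa [Finset.sum_range_succ] using this
  simp only [nsmul_eq_mul, Nat.cast_mul, h01, h12]
  linear_combination ((q - 1 : ℕ) : F) * (w 2 : F) * (hζsum + ζ * hζ3)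

/-- The sorted solutions of `a + b + c = 0`, `a² + b² + c² = 6s²` are separated by `±s`, and `±s`
occurs only in the middle. -/
theorem lt_neg_and_lt_of_sum_eq_zero {a b c s : ℝ} (hab : a ≤ b) (hbc : b ≤ c)
    (hsum : a + b + c = 0) (hsq : a ^ 2 + b ^ 2 + c ^ 2 = 6 * s ^ 2) (hs : 0 < s)
    (hb : b ≠ s) (hb' : b ≠ -s) : a < -s ∧ -s < b ∧ b < s ∧ s < c := by
  have hc : c = -a - b := by linarith
  have hac : a * c = b ^ 2 - 3 * s ^ 2 := by subst hc; nlinarith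
  have hb2 : b ^ 2 ≤ s ^ 2 := by nlinarith [mul_nonneg (sub_nonneg.2 hab) (sub_nonneg.2 hbc)]
  have h1 : -s < b := lt_of_le_of_ne (by nlinarith) (Ne.symm hb')
  have h2 : b < s := lt_of_le_of_ne (by nlinarith) hb
  have h3 : (s - a) * (s - c) < 0 := by
    nlinarith [mul_pos (sub_pos.2 h2) (show 0 < b + 2 * s by linarith)]
  have h4 : (-s - a) * (-s - c) < 0 := by
    nlinarith [mul_pos (show 0 < b + s by linarith) (show 0 < 2 * s - b by linarith)]
  refine ⟨?_, h1, h2, ?_⟩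
  · by_contra! h
    nlinarith
  · by_contra! h
    nlinarith

open scoped Classical in
/-- The number of points of a line in an orbit, in terms of vectors. -/
theorem Submodule.card_filter_pow_eq_mul_ncard {K F : Type*} [Field K] [Field F] [Algebra K F]
    [Fintype F] {q E : ℕ} (hcardK : Nat.card K = q) (hE0 : E ≠ 0) (hqE : q - 1 ∣ E) {α : F}
    (hprim : ∀ x : F, x ≠ 0 → ∃ i : ℕ, α ^ i = x) (hζ : IsPrimitiveRoot (α ^ E) 3)
    (ℓ : Submodule K F) (u : ℕ) :
    (Finset.univ.filter fun x : F => x ∈ ℓ ∧ x ^ E = (α ^ E) ^ u).card = (q - 1) *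
      {P : Submodule K F | (∃ i : ℕ, i % 3 = u % 3 ∧ P = Submodule.span K {α ^ i}) ∧
        P ≤ ℓ}.ncard := by
  have := Finite.of_injective _ (FaithfulSMul.algebraMap_injective K F)
  have := Fintype.ofFinite K
  have hcK : Fintype.card K = q := by rw [← hcardK, Nat.card_eq_fintype_card]
  have hζ0 : α ^ E ≠ 0 := hζ.ne_zero (by norm_num)
  have hpow : ∀ i, (α ^ i) ^ E = (α ^ E) ^ u ↔ i % 3 = u % 3 := by
    intro i
    rw [← pow_mul, mul_comm, pow_mul, ← pow_mod_orderOf, ← pow_mod_orderOf _ u, ← hζ.eq_orderOf]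
    exact ⟨fun h => hζ.pow_inj (Nat.mod_lt _ (by norm_num)) (Nat.mod_lt _ (by norm_num)) h,
      fun h => by rw [h]⟩
  rw [Finset.card_eq_mul_card_image_span (K := K), hcardK, ← Set.ncard_coe_finset]
  · congr 2
    ext P
    simp only [Finset.coe_image, Finset.coe_filter, Finset.mem_univ, true_and, Set.mem_image,
      Set.mem_ofPred_eq]
    constructor
    · rintro ⟨x, ⟨hx, hxE⟩, rfl⟩
      have hx0 : x ≠ 0 := by
        rintro rfl
        rw [zero_pow hE0] at hxE
        exact pow_ne_zero u hζ0 hxE.symm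
      obtain ⟨i, rfl⟩ := hprim x hx0
      exact ⟨⟨i, (hpow i).1 hxE, rfl⟩, by simpa using hx⟩
    · rintro ⟨⟨i, hi, rfl⟩, hP⟩
      exact ⟨α ^ i, ⟨by simpa using hP, (hpow i).2 hi⟩, rfl⟩
  · simp only [Finset.mem_filter, Finset.mem_univ, true_and, zero_pow hE0, not_and]
    exact fun _ h => pow_ne_zero u hζ0 h.symm
  · intro c x hx
    simp only [Finset.mem_filter, Finset.mem_univ, true_and] at hx ⊢
    obtain ⟨n, rfl⟩ := hqE
    refine ⟨ℓ.smul_mem _ hx.1, ?_⟩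
    rw [smul_pow, pow_mul (c : K), ← hcK, FiniteField.pow_card_sub_one_eq_one _ c.ne_zero, one_pow,
      one_smul, hcK, hx.2]

open scoped Classical in
/-- If `p ≡ 2 (mod 3)`, the Frobenius map interchanges the nontrivial cubic residue classes on an
invariant subspace. -/
theorem FiniteField.card_filter_pow_eq_of_frobenius {F : Type*} [Field F] [Fintype F] {p E : ℕ}
    [Fact p.Prime] [CharP F p] (hp3 : p % 3 = 2) {ζ : F} (hζ : IsPrimitiveRoot ζ 3)
    (P : F → Prop) (hP : ∀ x, P x ↔ P (x ^ p)) :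
    (Finset.univ.filter fun x : F => P x ∧ x ^ E = ζ ^ 1).card =
      (Finset.univ.filter fun x : F => P x ∧ x ^ E = ζ ^ 2).card := by
  have hζp : ζ ^ p = ζ ^ 2 := by
    rw [← pow_mod_orderOf, ← hζ.eq_orderOf, hp3]
  have hbij : Function.Bijective (frobenius F p) := bijective_frobenius F p
  refine Finset.card_bij (fun x _ => x ^ p) ?_ ?_ ?_
  · intro x hx
    simp only [Finset.mem_filter, Finset.mem_univ, true_and] at hx ⊢
    rw [← hP, pow_right_comm, hx.2, pow_one]
    exact ⟨hx.1, hζp⟩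
  · intro a _ b _ hab
    exact hbij.1 hab
  · intro y hy
    obtain ⟨x, rfl⟩ := hbij.2 y
    simp only [Finset.mem_filter, Finset.mem_univ, true_and, frobenius_def] at hy ⊢
    refine ⟨x, ⟨(hP x).2 hy.1, hbij.1 ?_⟩, rfl⟩
    rw [frobenius_def, frobenius_def, pow_right_comm, hy.2, pow_one, hζp]

/-- The three intersection numbers when two of them coincide and `q = s²`. -/
theorem three_mul_eq_of_two_eq {q s a b : ℕ} (hqs : q = s ^ 2)
    (hsum : b + a + a = q + 1) (hsq : 3 * (b ^ 2 + a ^ 2 + a ^ 2) = q ^ 2 + 4 * q + 1) :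
    (s % 3 = 2 → 3 * (a : ℤ) = q + 1 - s ∧ 3 * (b : ℤ) = q + 1 + 2 * s) ∧
    (s % 3 = 1 → 3 * (a : ℤ) = q + 1 + s ∧ 3 * (b : ℤ) = q + 1 - 2 * s) := by
  zify at hqs hsum hsq
  have hb : (b : ℤ) = q + 1 - 2 * a := by linarith
  have h1 : (3 * (a : ℤ) - (q + 1) - s) * (3 * (a : ℤ) - (q + 1) + s) = 0 := by
    rw [hb] at hsq
    nlinarith only [hsq, hqs]
  have hmod : s % 3 ≠ 0 → (q : ℤ) % 3 = 1 := by
    intro hs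
    rcases (by omega : s % 3 = 1 ∨ s % 3 = 2) with h | h <;>
    · rw [hqs, pow_two, Int.mul_emod]
      have h' : (s : ℤ) % 3 = ((s % 3 : ℕ) : ℤ) := by simp
      rw [h', h]; norm_num
  rcases mul_eq_zero.1 h1 with h | h
  · constructor <;> intro hs <;> have := hmod (by omega) <;> omega
  · constructor <;> intro hs <;> have := hmod (by omega) <;> omega

theorem eq_of_insert_eq_range_three {i j k : ℕ} (h : ({i, j, k} : Finset ℕ) = {0, 1, 2}) :
    (i = 0 ∧ j = 1 ∧ k = 2) ∨ (i = 0 ∧ j = 2 ∧ k = 1) ∨ (i = 1 ∧ j = 0 ∧ k = 2) ∨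
      (i = 1 ∧ j = 2 ∧ k = 0) ∨ (i = 2 ∧ j = 0 ∧ k = 1) ∨ (i = 2 ∧ j = 1 ∧ k = 0) := by
  have h0 := Finset.ext_iff.1 h 0
  have h1 := Finset.ext_iff.1 h 1
  have h2 := Finset.ext_iff.1 h 2
  simp at h0 h1 h2
  omega

theorem eq_of_sorted_of_two_eq {w : ℕ → ℕ} {i j k : ℕ}
    (h : ({i, j, k} : Finset ℕ) = {0, 1, 2}) (hij : w i ≤ w j) (hjk : w j ≤ w k)
    (hw : w 1 = w 2) :
    (w 1 ≤ w 0 → w i = w 1 ∧ w j = w 1 ∧ w k = w 0) ∧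
      (w 0 ≤ w 1 → w i = w 0 ∧ w j = w 1 ∧ w k = w 1) := by
  rcases eq_of_insert_eq_range_three h with ⟨rfl, rfl, rfl⟩ | ⟨rfl, rfl, rfl⟩ | ⟨rfl, rfl, rfl⟩ |
    ⟨rfl, rfl, rfl⟩ | ⟨rfl, rfl, rfl⟩ | ⟨rfl, rfl, rfl⟩ <;> clear h <;> omega

set_option maxHeartbeats 1000000 in
/-- Singer model of `PG(2,q)`, `q = p^h`, with `3 ∣ q²+q+1`, `t = 3`, `d = (q²+q+1)/3`,
`ℓ0` a line invariant under `τ : P_i ↦ P_{(i·p) mod v}`, `w u = |ℓ0 ∩ O u|` for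
`u = 0,1,2`.  Let `i0, i1, i2` be the permutation of `{0,1,2}` with
`w i0 ≤ w i1 ≤ w i2` and set (as real numbers) `A = (q−√q+1)/3`, `B = (q+√q+1)/3`,
`C = (q−2√q+1)/3`, `D = (q+2√q+1)/3`.  Then:
(i) if `q` is a non-square, or `q = p^{2m}` with `p ≡ 1 (mod 3)`, then `w i0 < A`,
    `A < w i1 < B` and `w i2 > B`;
(ii) if `q = p^{4m+2}` with `p ≡ 2 (mod 3)` then `√q ≡ 2 (mod 3)` and
     `w i0 = w i1 = A`, `w i2 = D`;
(iii) if `q = p^{4m}` with `p ≡ 2 (mod 3)` then `√q ≡ 1 (mod 3)` and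
     `w i0 = C`, `w i1 = w i2 = B`. -/
theorem stmt11
    (p h q v : ℕ) (hp : p.Prime) (hh : 1 ≤ h) (hq : q = p ^ h)
    (hv : v = q ^ 2 + q + 1)
    (F : Type) [Field F] [Fintype F] (hcard : Nat.card F = q ^ 3)
    (Fq : Subfield F) (hcardq : Nat.card Fq = q)
    (α : F) (hα : α ≠ 0) (hprim : ∀ x : F, x ≠ 0 → ∃ i : ℕ, α ^ i = x)
    (Pt : ℕ → Submodule Fq F) (hPt : ∀ i : ℕ, Pt i = Submodule.span Fq {α ^ i})
    (d t : ℕ) (hd : 0 < d) (hdt : v = d * t)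
    (O : ℕ → Set (Submodule Fq F))
    (hO : ∀ u : ℕ, O u = {P : Submodule Fq F | ∃ i : ℕ, i % t = u % t ∧ P = Pt i})
    (ℓ0 : Submodule Fq F) (hline : Module.finrank Fq ℓ0 = 2)
    (w : ℕ → ℕ)
    (hw : ∀ u : ℕ, w u = {P : Submodule Fq F | P ∈ O u ∧ P ≤ ℓ0}.ncard)
    (hinv : ∀ i : ℕ, α ^ i ∈ ℓ0 ↔ α ^ ((i * p) % v) ∈ ℓ0)
    (ht : t = 3) (h3 : 3 ∣ v)
    (i0 i1 i2 : ℕ) (hperm : ({i0, i1, i2} : Finset ℕ) = {0, 1, 2})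
    (hsort01 : w i0 ≤ w i1) (hsort12 : w i1 ≤ w i2)
    (A B C D : ℝ)
    (hA : A = ((q : ℝ) - Real.sqrt q + 1) / 3)
    (hB : B = ((q : ℝ) + Real.sqrt q + 1) / 3)
    (hC : C = ((q : ℝ) - 2 * Real.sqrt q + 1) / 3)
    (hD : D = ((q : ℝ) + 2 * Real.sqrt q + 1) / 3)
    :
    (((¬ ∃ m : ℕ, q = m ^ 2) ∨ ((∃ m : ℕ, h = 2 * m) ∧ p % 3 = 1)) →
      (w i0 : ℝ) < A ∧ A < (w i1 : ℝ) ∧ (w i1 : ℝ) < B ∧ B < (w i2 : ℝ)) ∧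
    (∀ m : ℕ, h = 4 * m + 2 → p % 3 = 2 →
      Nat.sqrt q % 3 = 2 ∧ (w i0 : ℝ) = A ∧ (w i1 : ℝ) = A ∧ (w i2 : ℝ) = D) ∧
    (∀ m : ℕ, h = 4 * m → p % 3 = 2 →
      Nat.sqrt q % 3 = 1 ∧ (w i0 : ℝ) = C ∧ (w i1 : ℝ) = B ∧ (w i2 : ℝ) = B) := by
  
  classical
  subst ht
  have hp' := Fact.mk hp
  have hq3 : q % 3 = 1 := by
    have h1 : (q ^ 2 + q + 1) % 3 = 0 := by rw [← hv]; exact Nat.mod_eq_zero_of_dvd h3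
    have h2 : q % 3 = 0 ∨ q % 3 = 1 ∨ q % 3 = 2 := by omega
    rcases h2 with h | h | h <;> simp [Nat.add_mod, Nat.pow_mod, h] at h1 ⊢
  have hq2 : 2 ≤ q := hq ▸ hp.two_le.trans (Nat.le_self_pow (by omega) p)
  obtain ⟨k, hk⟩ : ∃ k, q = 3 * k + 1 := ⟨q / 3, by omega⟩
  have hk0 : 0 < k := by omega
  have := Fintype.ofFinite Fq
  have hcF : Fintype.card F = q ^ 3 := by rw [← hcard, Nat.card_eq_fintype_card]
  have hrank : Module.finrank Fq F = 3 := by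
    have h1 := Module.natCard_eq_pow_finrank (K := Fq) (V := F)
    rw [hcard, hcardq] at h1
    exact (Nat.pow_right_injective hq2 h1).symm
  have : CharP F p := charP_of_card_eq_prime_pow (f := h * 3) (by rw [hcF, hq, pow_mul])
  have hc : q ^ 3 - 1 = 3 * (k * (q ^ 2 + q + 1)) := by
    rw [hk]; apply Nat.sub_eq_of_eq_add; ring
  have hE0 : k * (q ^ 2 + q + 1) ≠ 0 := by positivity
  have hqE : q - 1 ∣ k * (q ^ 2 + q + 1) :=
    ⟨3 * k ^ 2 + 3 * k + 1, by rw [hk, Nat.add_sub_cancel]; ring⟩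
  have hζ : IsPrimitiveRoot (α ^ (k * (q ^ 2 + q + 1))) 3 := by
    have h1 : orderOf (α ^ (k * (q ^ 2 + q + 1))) = 3 := by
      apply orderOf_eq_prime
      · rw [← pow_mul, mul_comm, ← hc, ← hcF, FiniteField.pow_card_sub_one_eq_one α hα]
      · intro h1
        have h2 : ∀ x : Fˣ, x ^ (k * (q ^ 2 + q + 1)) = 1 := by
          intro x
          obtain ⟨i, hi⟩ := hprim x x.ne_zero
          ext
          rw [Units.val_pow_eq_pow_val, ← hi, ← pow_mul, mul_comm, pow_mul, h1, one_pow,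
            Units.val_one]
        rw [FiniteField.forall_pow_eq_one_iff, hcF, hc] at h2
        have := Nat.le_of_dvd (by omega) h2
        omega
    exact h1 ▸ IsPrimitiveRoot.orderOf _
  have hcount : ∀ u < 3, (Finset.univ.filter fun x : F => x ∈ ℓ0 ∧
      x ^ (k * (q ^ 2 + q + 1)) = (α ^ (k * (q ^ 2 + q + 1))) ^ u).card = (q - 1) * w u := by
    intro u _
    rw [ℓ0.card_filter_pow_eq_mul_ncard hcardq hE0 hqE hprim hζ u, hw, hO]
    simp only [hPt, Set.mem_ofPred_eq]
  obtain ⟨hsum, hsq⟩ := Submodule.sum_orbit_counts hcardq hrank hk hk0 hline hζ w hcount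
  have hcases := eq_of_insert_eq_range_three hperm
  have hqpos : (0 : ℝ) < q := by exact_mod_cast two_pos.trans_le hq2
  have hs : 0 < √(q : ℝ) := Real.sqrt_pos.2 hqpos
  have hss : √(q : ℝ) ^ 2 = q := Real.sq_sqrt hqpos.le
  have hw12 : p % 3 = 2 → w 1 = w 2 := by
    intro hp3
    have hinv' : ∀ x, x ∈ ℓ0 ↔ x ^ p ∈ ℓ0 := by
      intro x
      by_cases hx : x = 0
      · simp [hx, hp.ne_zero]
      obtain ⟨i, rfl⟩ := hprim x hx
      have hnorm : α ^ v = algebraMap Fq F (Algebra.norm Fq α) := by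
        rw [FiniteField.algebraMap_norm_eq_prod_pow, hrank, hcardq, hv]
        simp only [Finset.prod_range_succ, Finset.prod_range_zero, one_mul, ← pow_add]
        congr 1
        ring
      have hN : Algebra.norm Fq α ≠ 0 := by rwa [Algebra.norm_ne_zero_iff]
      rw [hinv i, ← pow_mul]
      conv_rhs => rw [← Nat.mod_add_div (i * p) v, pow_add, pow_mul, hnorm, ← map_pow, mul_comm,
        ← Algebra.smul_def]
      exact (ℓ0.smul_mem_iff (pow_ne_zero _ hN)).symm
    have h1 := FiniteField.card_filter_pow_eq_of_frobenius (E := k * (q ^ 2 + q + 1)) hp3 hζ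
      (fun x => x ∈ ℓ0) hinv'
    rw [hcount 1 (by norm_num), hcount 2 (by norm_num)] at h1
    exact Nat.eq_of_mul_eq_mul_left (by omega) h1
  have hsqrt : ∀ s : ℕ, q = s ^ 2 → √(q : ℝ) = s := by
    rintro s rfl
    rw [Nat.cast_pow, Real.sqrt_sq (Nat.cast_nonneg s)]
  refine ⟨fun hcond => ?_, fun m hm hp3 => ?_, fun m hm hp3 => ?_⟩
  · have hsum' : w i0 + w i1 + w i2 = q + 1 := by
      rcases hcases with ⟨rfl, rfl, rfl⟩ | ⟨rfl, rfl, rfl⟩ | ⟨rfl, rfl, rfl⟩ | ⟨rfl, rfl, rfl⟩ |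
        ⟨rfl, rfl, rfl⟩ | ⟨rfl, rfl, rfl⟩ <;> linarith
    have hsq' : 3 * (w i0 ^ 2 + w i1 ^ 2 + w i2 ^ 2) = q ^ 2 + 4 * q + 1 := by
      rcases hcases with ⟨rfl, rfl, rfl⟩ | ⟨rfl, rfl, rfl⟩ | ⟨rfl, rfl, rfl⟩ | ⟨rfl, rfl, rfl⟩ |
        ⟨rfl, rfl, rfl⟩ | ⟨rfl, rfl, rfl⟩ <;> linarith
    have hmid : (3 * (w i1 : ℤ) - (q + 1)) ^ 2 ≠ q := by
      intro hB
      rcases hcond with hns | ⟨-, hp1⟩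
      · refine hns ⟨(3 * (w i1 : ℤ) - (q + 1)).natAbs, ?_⟩
        zify
        rw [sq_abs, hB]
      · obtain ⟨r, hr⟩ : ∃ r, p = 3 * r + 1 := ⟨p / 3, by omega⟩
        have hpq : (p : ℤ) ∣ q := by
          rw [hq]; exact_mod_cast dvd_pow_self p (by omega)
        have hpZ : Prime (p : ℤ) := Nat.prime_iff_prime_int.1 hp
        zify at hsum' hsq'
        have hd1 : (p : ℤ) ∣ 3 * (w i1 : ℤ) - (q + 1) := hpZ.dvd_of_dvd_pow (hB ▸ hpq)
        have hd0 : (p : ℤ) ∣ 3 * (w i0 : ℤ) - (q + 1) := by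
          refine hpZ.dvd_of_dvd_pow (n := 2) ?_
          have : (3 * (w i0 : ℤ) - (q + 1)) ^ 2 =
              2 * q - (3 * (w i0 : ℤ) - (q + 1)) * (3 * (w i1 : ℤ) - (q + 1)) := by
            have h2 : (w i2 : ℤ) = q + 1 - w i0 - w i1 := by linarith
            rw [h2] at hsq'
            nlinarith only [hsq', hB]
          rw [this]
          exact dvd_sub (hpq.mul_left _) (hd1.mul_left _)
        have hd2 : (p : ℤ) ∣ 3 * (w i2 : ℤ) - (q + 1) := by
          have : 3 * (w i2 : ℤ) - (q + 1) =
              -((3 * (w i0 : ℤ) - (q + 1)) + (3 * (w i1 : ℤ) - (q + 1))) := by linarith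
          rw [this]
          exact (hd0.add hd1).neg_right
        have hqF : (q : F) = 0 := by
          have := (CharP.intCast_eq_zero_iff F p q).2 hpq
          simpa using this
        have hF : ∀ i : ℕ, (p : ℤ) ∣ 3 * (w i : ℤ) - (q + 1) → (3 : F) * w i = 1 := by
          intro i hi
          have := (CharP.intCast_eq_zero_iff F p _).2 hi
          push_cast at this
          rw [hqF] at this
          linear_combination this
        have h3F : (3 : F) ≠ 0 := fun h0 => by simpa [h0] using hF _ hd0
        refine Submodule.orbit_counts_not_congruent hp hr hq hcardq hrank hk hk0 hline hζ w hcount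
          ⟨mul_left_cancel₀ h3F ?_, mul_left_cancel₀ h3F ?_⟩ <;>
        rcases hcases with ⟨rfl, rfl, rfl⟩ | ⟨rfl, rfl, rfl⟩ | ⟨rfl, rfl, rfl⟩ | ⟨rfl, rfl, rfl⟩ |
          ⟨rfl, rfl, rfl⟩ | ⟨rfl, rfl, rfl⟩ <;>
        simp only [hF _ hd0, hF _ hd1, hF _ hd2]
    have hsumR : (w i0 : ℝ) + w i1 + w i2 = q + 1 := by exact_mod_cast hsum'
    have hsqR : 3 * ((w i0 : ℝ) ^ 2 + (w i1 : ℝ) ^ 2 + (w i2 : ℝ) ^ 2) = q ^ 2 + 4 * q + 1 := by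
      exact_mod_cast hsq'
    have h01R : (w i0 : ℝ) ≤ w i1 := by exact_mod_cast hsort01
    have h12R : (w i1 : ℝ) ≤ w i2 := by exact_mod_cast hsort12
    have hmidR : (3 * (w i1 : ℝ) - (q + 1)) ^ 2 ≠ √(q : ℝ) ^ 2 := by
      rw [hss]; exact_mod_cast hmid
    obtain ⟨h1, h2, h3, h4⟩ := lt_neg_and_lt_of_sum_eq_zero (s := √(q : ℝ))
      (a := 3 * (w i0 : ℝ) - (q + 1)) (b := 3 * (w i1 : ℝ) - (q + 1))
      (c := 3 * (w i2 : ℝ) - (q + 1)) (by linarith) (by linarith) (by linarith)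
      (by rw [hss]; linear_combination 3 * hsqR - 6 * (q + 1 : ℝ) * hsumR) hs
      (fun h => hmidR (by rw [h])) (fun h => hmidR (by rw [h, neg_sq]))
    subst hA hB
    refine ⟨?_, ?_, ?_, ?_⟩ <;> linarith
  · have hqs : q = (p ^ (2 * m + 1)) ^ 2 := by rw [hq, hm, ← pow_mul]; ring_nf
    have hs3 : p ^ (2 * m + 1) % 3 = 2 := by
      rw [Nat.pow_mod, hp3, pow_succ, pow_mul, Nat.mul_mod, Nat.pow_mod]; norm_num
    have hspos : 0 < p ^ (2 * m + 1) := pow_pos hp.pos _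
    have hR := hsqrt _ hqs
    set s := p ^ (2 * m + 1)
    rw [← hw12 hp3] at hsum hsq
    obtain ⟨ha, hb⟩ := (three_mul_eq_of_two_eq hqs hsum hsq).1 hs3
    have hval := (eq_of_sorted_of_two_eq hperm hsort01 hsort12 (hw12 hp3)).1 (by linarith)
    have haR : 3 * (w 1 : ℝ) = q + 1 - s := by exact_mod_cast ha
    have hbR : 3 * (w 0 : ℝ) = q + 1 + 2 * s := by exact_mod_cast hb
    rw [hval.1, hval.2.1, hval.2.2, hA, hD, hR]
    refine ⟨by rw [hqs, Nat.sqrt_eq', hs3], ?_, ?_, ?_⟩ <;> linarith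
  · have hqs : q = (p ^ (2 * m)) ^ 2 := by rw [hq, hm, ← pow_mul]; ring_nf
    have hs3 : p ^ (2 * m) % 3 = 1 := by
      rw [Nat.pow_mod, hp3, pow_mul, Nat.pow_mod]; norm_num
    have hspos : 0 < p ^ (2 * m) := pow_pos hp.pos _
    have hR := hsqrt _ hqs
    set s := p ^ (2 * m)
    rw [← hw12 hp3] at hsum hsq
    obtain ⟨ha, hb⟩ := (three_mul_eq_of_two_eq hqs hsum hsq).2 hs3
    have hval := (eq_of_sorted_of_two_eq hperm hsort01 hsort12 (hw12 hp3)).2 (by linarith)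
    have haR : 3 * (w 1 : ℝ) = q + 1 + s := by exact_mod_cast ha
    have hbR : 3 * (w 0 : ℝ) = q + 1 - 2 * s := by exact_mod_cast hb
    rw [hval.1, hval.2.1, hval.2.2, hB, hC, hR]
    refine ⟨by rw [hqs, Nat.sqrt_eq', hs3], ?_, ?_, ?_⟩ <;> linarith
end

section
/- In the Singer model of PG(2,q), assume 3 divides q²+q+1 and take t = 3, d = (q²+q+1)/3, with ℓ_0 any fixed line and w_u = |ℓ_0 ∩ O_u| for u = 0,1,2. Then for any two distinct indices i, j ∈ {0,1,2} there exists a nonnegative integer s such that 4q − (3(w_i + w_j) − 2(q+1))² = 3s². -/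
section PlaneStabilizer

variable {K F : Type*} [Field K] [Field F] [Algebra K F]

/-- In a cubic extension, multiplication by an element outside the base field fixes no plane. -/
theorem mem_range_algebraMap_of_mul_mem (hF : Module.finrank K F = 3) (ℓ : Submodule K F)
    (hℓ : Module.finrank K ℓ = 2) (h : F) (hmul : ∀ x ∈ ℓ, h * x ∈ ℓ) :
    h ∈ (algebraMap K F).range := by
  have : FiniteDimensional K F := Module.finite_of_finrank_pos (by omega)
  let f : ℓ →ₗ[K] ℓ := (LinearMap.mulLeft K h).restrict hmul
  have haeval (p : Polynomial K) (z : ℓ) :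
      ((Polynomial.aeval f p z : ℓ) : F) = Polynomial.aeval h p * z := by
    induction p using Polynomial.induction_on' generalizing z with
    | add p q hp hq => simp [hp, hq, add_mul]
    | monomial n a =>
      have hpow (z : ℓ) : (((f ^ n) z : ℓ) : F) = h ^ n * z := by
        induction n generalizing z with
        | zero => simp
        | succ n ih =>
          rw [pow_succ, Module.End.mul_apply, ih, pow_succ, mul_assoc]
          rfl
      simp [Polynomial.aeval_monomial, hpow, Algebra.smul_def, mul_assoc]
  have : Nontrivial ℓ := Module.nontrivial_of_finrank_pos (R := K) (by omega)
  obtain ⟨z, hz⟩ := exists_ne (0 : ℓ)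
  have hroot : Polynomial.aeval h f.charpoly = 0 := by
    have := haeval f.charpoly z
    rw [LinearMap.aeval_self_charpoly] at this
    simpa [hz, eq_comm] using this
  have hle : (minpoly K h).natDegree ≤ 2 := by
    rw [← hℓ, ← f.charpoly_natDegree]
    exact Polynomial.natDegree_le_of_dvd (minpoly.dvd K h hroot) f.charpoly_monic.ne_zero
  have hdvd := minpoly.degree_dvd (Algebra.IsIntegral.isIntegral (R := K) h)
  rw [hF] at hdvd
  rw [← minpoly.natDegree_eq_one_iff]
  rcases (Nat.dvd_prime Nat.prime_three).mp hdvd with h1 | h3 <;> omega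

theorem finrank_inf_map_mulLeft (hF : Module.finrank K F = 3) (ℓ : Submodule K F)
    (hℓ : Module.finrank K ℓ = 2) (h : F) (hh : h ∉ (algebraMap K F).range) :
    Module.finrank K (ℓ ⊓ ℓ.map (LinearMap.mulLeft K h) : Submodule K F) = 1 := by
  have : FiniteDimensional K F := Module.finite_of_finrank_pos (by omega)
  have h0 : h ≠ 0 := by
    rintro rfl
    exact hh (zero_mem _)
  have hinj : Function.Injective (LinearMap.mulLeft K h) := mul_right_injective₀ h0
  have hmap : Module.finrank K (ℓ.map (LinearMap.mulLeft K h)) = 2 := by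
    rw [← hℓ, (Submodule.equivMapOfInjective _ hinj ℓ).finrank_eq]
  have hsum := Submodule.finrank_sup_add_finrank_inf_eq ℓ (ℓ.map (LinearMap.mulLeft K h))
  have hsup := Submodule.finrank_le (ℓ ⊔ ℓ.map (LinearMap.mulLeft K h))
  have hinf := Submodule.finrank_mono
    (inf_le_left : ℓ ⊓ ℓ.map (LinearMap.mulLeft K h) ≤ ℓ)
  by_contra hne
  have heq : Module.finrank K (ℓ ⊓ ℓ.map (LinearMap.mulLeft K h) : Submodule K F) = 2 := by
    omega
  have h1 := Submodule.eq_of_le_of_finrank_eq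
    (inf_le_left : ℓ ⊓ ℓ.map (LinearMap.mulLeft K h) ≤ ℓ) (heq.trans hℓ.symm)
  have h2 := Submodule.eq_of_le_of_finrank_eq
    (inf_le_right : ℓ ⊓ ℓ.map (LinearMap.mulLeft K h) ≤ _) (heq.trans hmap.symm)
  refine hh (mem_range_algebraMap_of_mul_mem hF ℓ hℓ h fun x hx => ?_)
  have hx' := Submodule.mem_map_of_mem (f := LinearMap.mulLeft K h) hx
  rw [← h2, h1] at hx'
  simpa using hx'

end PlaneStabilizer

section CubicClasses

open Finset
open scoped Classical

variable {F : Type*} [Field F] {c : F → ZMod 3}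

theorem class_div (hc : ∀ x y : F, x ≠ 0 → y ≠ 0 → c (x * y) = c x + c y) {x y : F}
    (hx : x ≠ 0) (hy : y ≠ 0) : c (x / y) = c x - c y := by
  have := hc (x / y) y (div_ne_zero hx hy) hy
  rw [div_mul_cancel₀ x hy] at this
  rw [this, add_sub_cancel_right]

variable {K : Type*} [Field K] [Fintype F] [Algebra K F]

theorem card_filter_ne_zero_mem (V : Submodule K F) :
    #{x : F | x ≠ 0 ∧ x ∈ V} + 1 = Nat.card K ^ Module.finrank K V := by
  have : Module.Finite K F := Module.Finite.of_finite
  have hins : insert 0 ({x : F | x ≠ 0 ∧ x ∈ V} : Finset F) = ({x : F | x ∈ V} : Finset F) := by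
    ext x
    by_cases hx : x = 0 <;> simp [hx]
  rw [← Module.natCard_eq_pow_finrank, ← Finset.card_insert_of_notMem (a := 0) (by simp), hins,
    Nat.subtype_card ({x : F | x ∈ V} : Finset F) fun x => by rw [mem_filter_univ]]

theorem card_filter_ne_zero_mem_range :
    #{x : F | x ≠ 0 ∧ x ∈ (algebraMap K F).range} + 1 = Nat.card K := by
  have h := card_filter_ne_zero_mem (K ∙ (1 : F))
  rw [finrank_span_singleton one_ne_zero, pow_one] at h
  rw [← h]
  congr 2
  ext x
  simp [Submodule.mem_span_singleton, Algebra.smul_def]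

/-- The nonzero vectors of `V` in the class `u`. -/
noncomputable def classVectors (V : Submodule K F) (c : F → ZMod 3) (u : ZMod 3) : Finset F :=
  {x : F | (x ≠ 0 ∧ x ∈ V) ∧ c x = u}

theorem three_mul_card_class_zero (hc : ∀ x y : F, x ≠ 0 → y ≠ 0 → c (x * y) = c x + c y)
    {α : F} (hα : α ≠ 0) (hcα : ∀ i : ℕ, c (α ^ i) = i) :
    3 * #{x : F | x ≠ 0 ∧ c x = 0} = #{x : F | x ≠ 0} := by
  have hfib (u : ZMod 3) : #{x ∈ ({x : F | x ≠ 0} : Finset F) | c x = u}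
      = #{x : F | x ≠ 0 ∧ c x = 0} := by
    have hu : c (α ^ u.val) = u := by simp [hcα]
    have h0 : α ^ u.val ≠ 0 := pow_ne_zero _ hα
    refine Finset.card_nbij' (· / α ^ u.val) (· * α ^ u.val) ?_ ?_ ?_ ?_
    · intro x hx
      simp only [coe_filter, mem_filter, mem_univ, true_and, Set.mem_ofPred_eq] at hx ⊢
      exact ⟨div_ne_zero hx.1 h0, by rw [class_div hc hx.1 h0, hx.2, hu, sub_self]⟩
    · intro x hx
      simp only [coe_filter, mem_filter, mem_univ, true_and, Set.mem_ofPred_eq] at hx ⊢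
      exact ⟨mul_ne_zero hx.1 h0, by rw [hc x _ hx.1 h0, hx.2, hu, zero_add]⟩
    · intro x _
      exact div_mul_cancel₀ x h0
    · intro x _
      exact mul_div_cancel_right₀ x h0
  rw [Finset.card_eq_sum_card_fiberwise (f := c) (s := {x : F | x ≠ 0}) (t := univ)
    fun _ _ => by simp]
  simp [hfib]

theorem sum_card_classVectors (V : Submodule K F) :
    ∑ u, #(classVectors V c u) = #{x : F | x ≠ 0 ∧ x ∈ V} := by
  rw [Finset.card_eq_sum_card_fiberwise (f := c) (t := univ) fun _ _ => by simp]
  exact Finset.sum_congr rfl fun u _ => by rw [classVectors, Finset.filter_filter]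

theorem sum_card_classVectors_sq (hc : ∀ x y : F, x ≠ 0 → y ≠ 0 → c (x * y) = c x + c y)
    (V : Submodule K F) :
    ∑ u, #(classVectors V c u) ^ 2 = ∑ h : F with h ≠ 0 ∧ c h = 0,
      #{x : F | x ≠ 0 ∧ x ∈ V ⊓ V.map (LinearMap.mulLeft K h)} := by
  set T : Finset (F × F) :=
    {z : F × F | (z.1 ≠ 0 ∧ z.1 ∈ V) ∧ (z.2 ≠ 0 ∧ z.2 ∈ V) ∧ c z.1 = c z.2} with hT
  trans #T
  · rw [Finset.card_eq_sum_card_fiberwise (f := fun z : F × F => c z.1) (t := univ)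
      fun _ _ => by simp]
    refine Finset.sum_congr rfl fun u _ => ?_
    rw [sq, ← Finset.card_product]
    congr 1
    ext z
    simp only [classVectors, hT, mem_product, mem_filter, mem_univ, true_and]
    grind
  · rw [Finset.card_eq_sum_card_fiberwise (f := fun z : F × F => z.1 / z.2)
      (t := {h : F | h ≠ 0 ∧ c h = 0})]
    · refine Finset.sum_congr rfl fun h hh => ?_
      simp only [mem_filter, mem_univ, true_and] at hh
      refine Finset.card_nbij' (fun z => z.1) (fun x => (x, x / h)) ?_ ?_ ?_ ?_
      · rintro ⟨x, y⟩ hz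
        simp only [hT, coe_filter, mem_filter, mem_univ, true_and, Set.mem_ofPred_eq] at hz ⊢
        obtain ⟨⟨hx, hy, -⟩, rfl⟩ := hz
        exact ⟨hx.1, hx.2, Submodule.mem_map.mpr ⟨y, hy.2, by simp [div_mul_cancel₀ x hy.1]⟩⟩
      · intro x hx
        simp only [hT, coe_filter, mem_filter, mem_univ, true_and, Set.mem_ofPred_eq,
          Submodule.mem_inf, Submodule.mem_map, LinearMap.mulLeft_apply] at hx ⊢
        obtain ⟨hx0, hxV, y, hy, rfl⟩ := hx
        refine ⟨⟨⟨hx0, hxV⟩, ⟨div_ne_zero hx0 hh.1, ?_⟩, ?_⟩, ?_⟩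
        · rwa [mul_div_cancel_left₀ y hh.1]
        · rw [class_div hc hx0 hh.1, hh.2, sub_zero]
        · exact div_div_cancel₀ hx0
      · rintro ⟨x, y⟩ hz
        simp only [hT, coe_filter, mem_filter, mem_univ, true_and, Set.mem_ofPred_eq] at hz
        obtain ⟨⟨hx, hy, -⟩, rfl⟩ := hz
        simp [div_div_cancel₀ hx.1]
      · intro x _
        rfl
    · rintro ⟨x, y⟩ hz
      simp only [hT, coe_filter, mem_univ, true_and, Set.mem_ofPred_eq] at hz ⊢
      exact ⟨div_ne_zero hz.1.1 hz.2.1.1,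
        by rw [class_div hc hz.1.1 hz.2.1.1, hz.2.2, sub_self]⟩

theorem three_mul_sum_card_classVectors_sq
    (hc : ∀ x y : F, x ≠ 0 → y ≠ 0 → c (x * y) = c x + c y)
    {α : F} (hα : α ≠ 0) (hcα : ∀ i : ℕ, c (α ^ i) = i)
    (hcK : ∀ a : K, a ≠ 0 → c (algebraMap K F a) = 0)
    (hF : Module.finrank K F = 3) (ℓ : Submodule K F) (hℓ : Module.finrank K ℓ = 2)
    {m : ℕ} (hm : Nat.card K = m + 1) :
    3 * ∑ u, #(classVectors ℓ c u) ^ 2 = m ^ 2 * ((m + 1) ^ 2 + 4 * (m + 1) + 1) := by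
  have hscal := card_filter_ne_zero_mem_range (K := K) (F := F)
  have hclass := three_mul_card_class_zero hc hα hcα
  have hall := card_filter_ne_zero_mem (⊤ : Submodule K F)
  simp only [Submodule.mem_top, and_true, finrank_top, hF] at hall
  rw [hm] at hscal hall
  rw [sum_card_classVectors_sq hc,
    ← Finset.sum_filter_add_sum_filter_not _ (p := fun x => x ∈ (algebraMap K F).range),
    Finset.filter_filter, Finset.filter_filter]
  have hin : ∀ h ∈ ({x : F | (x ≠ 0 ∧ c x = 0) ∧ x ∈ (algebraMap K F).range} : Finset F),
      #{x : F | x ≠ 0 ∧ x ∈ ℓ ⊓ ℓ.map (LinearMap.mulLeft K h)} = m ^ 2 + 2 * m := by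
    intro h hh
    simp only [mem_filter, mem_univ, true_and] at hh
    obtain ⟨⟨h0, -⟩, a, rfl⟩ := hh
    have ha : a ≠ 0 := by
      rintro rfl
      simp at h0
    have hle : ℓ ≤ ℓ.map (LinearMap.mulLeft K (algebraMap K F a)) := fun x hx =>
      ⟨a⁻¹ • x, ℓ.smul_mem _ hx, by simp [← Algebra.smul_def, smul_smul, ha]⟩
    have := card_filter_ne_zero_mem (ℓ ⊓ ℓ.map (LinearMap.mulLeft K (algebraMap K F a)))
    rw [inf_eq_left.mpr hle, hℓ, hm] at this
    rw [inf_eq_left.mpr hle]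
    linarith
  have hout : ∀ h ∈ ({x : F | (x ≠ 0 ∧ c x = 0) ∧ x ∉ (algebraMap K F).range} : Finset F),
      #{x : F | x ≠ 0 ∧ x ∈ ℓ ⊓ ℓ.map (LinearMap.mulLeft K h)} = m := by
    intro h hh
    simp only [mem_filter, mem_univ, true_and] at hh
    have := card_filter_ne_zero_mem (ℓ ⊓ ℓ.map (LinearMap.mulLeft K h))
    rw [finrank_inf_map_mulLeft hF ℓ hℓ h hh.2, hm] at this
    linarith
  rw [Finset.sum_const_nat hin, Finset.sum_const_nat hout]
  rw [← Finset.card_filter_add_card_filter_not (s := ({x : F | x ≠ 0 ∧ c x = 0} : Finset F))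
    (p := fun x => x ∈ (algebraMap K F).range),
    Finset.filter_filter, Finset.filter_filter] at hclass
  have hA : #{x : F | (x ≠ 0 ∧ c x = 0) ∧ x ∈ (algebraMap K F).range} = m := by
    rw [← add_left_inj 1, ← hscal]
    congr 2
    ext x
    simp only [mem_filter, mem_univ, true_and]
    constructor
    · exact fun h => ⟨h.1.1, h.2⟩
    · rintro ⟨h0, a, rfl⟩
      exact ⟨⟨h0, hcK a (by rintro rfl; simp at h0)⟩, a, rfl⟩
  rw [hA] at hclass ⊢
  generalize #{x : F | (x ≠ 0 ∧ c x = 0) ∧ x ∉ (algebraMap K F).range} = B at *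
  have hB : 3 * B + 3 * m + 1 = (m + 1) ^ 3 := by omega
  zify at hB ⊢
  linear_combination (m : ℤ) * hB

theorem mul_ncard_points_eq_card_classVectors
    (hc : ∀ x y : F, x ≠ 0 → y ≠ 0 → c (x * y) = c x + c y)
    {α : F} (hα : α ≠ 0) (hcα : ∀ i : ℕ, c (α ^ i) = i)
    (hprim : ∀ x : F, x ≠ 0 → ∃ i : ℕ, α ^ i = x)
    (hcK : ∀ a : K, a ≠ 0 → c (algebraMap K F a) = 0)
    (ℓ : Submodule K F) (u : ℕ) {m : ℕ} (hm : Nat.card K = m + 1) :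
    m * {P : Submodule K F | (∃ i : ℕ, i % 3 = u % 3 ∧ P = K ∙ α ^ i) ∧ P ≤ ℓ}.ncard =
      #(classVectors ℓ c u) := by
  have himage : {P : Submodule K F | (∃ i : ℕ, i % 3 = u % 3 ∧ P = K ∙ α ^ i) ∧ P ≤ ℓ} =
      ((classVectors ℓ c u).image fun x => K ∙ x : Finset (Submodule K F)) := by
    ext P
    simp only [classVectors, Set.mem_ofPred_eq, coe_image, coe_filter, Set.mem_image, mem_univ,
      true_and]
    constructor
    · rintro ⟨⟨i, hi, rfl⟩, hP⟩
      refine ⟨α ^ i, ⟨⟨pow_ne_zero i hα, ?_⟩, ?_⟩, rfl⟩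
      · exact hP (Submodule.mem_span_singleton_self _)
      · rw [hcα]
        exact (ZMod.natCast_eq_natCast_iff' i u 3).mpr hi
    · rintro ⟨x, ⟨⟨hx0, hx⟩, hxu⟩, rfl⟩
      obtain ⟨i, rfl⟩ := hprim x hx0
      rw [hcα] at hxu
      exact ⟨⟨i, (ZMod.natCast_eq_natCast_iff' i u 3).mp hxu, rfl⟩,
        (Submodule.span_singleton_le_iff_mem _ _).mpr hx⟩
  rw [himage, Set.ncard_coe_finset, mul_comm]
  symm
  rw [Finset.card_eq_sum_card_image (fun x : F => K ∙ x)]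
  refine Finset.sum_const_nat fun P hP => ?_
  obtain ⟨y, hy, rfl⟩ := Finset.mem_image.mp hP
  simp only [classVectors, mem_filter, mem_univ, true_and] at hy
  obtain ⟨⟨hy0, hyℓ⟩, hyu⟩ := hy
  have hcard := card_filter_ne_zero_mem (K ∙ y)
  rw [finrank_span_singleton hy0, pow_one, hm, add_left_inj] at hcard
  rw [← hcard]
  congr 1
  ext x
  simp only [classVectors, mem_filter, mem_univ, true_and]
  constructor
  · rintro ⟨⟨⟨hx0, -⟩, -⟩, hxy⟩
    exact ⟨hx0, hxy ▸ Submodule.mem_span_singleton_self x⟩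
  · rintro ⟨hx0, hx⟩
    obtain ⟨a, rfl⟩ := Submodule.mem_span_singleton.mp hx
    have ha : a ≠ 0 := by
      rintro rfl
      simp at hx0
    refine ⟨⟨⟨hx0, ℓ.smul_mem a hyℓ⟩, ?_⟩, ?_⟩
    · rw [Algebra.smul_def, hc _ _ ((map_ne_zero _).mpr ha) hy0, hcK a ha, hyu, zero_add]
    · exact Submodule.span_singleton_smul_eq (IsUnit.mk0 a ha) y

end CubicClasses

theorem exists_classMap_primitive {F : Type*} [Field F] {α : F} (hα : α ≠ 0)
    (hprim : ∀ x : F, x ≠ 0 → ∃ i : ℕ, α ^ i = x) (hdvd : 3 ∣ orderOf α) :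
    ∃ c : F → ZMod 3, (∀ i : ℕ, c (α ^ i) = i) ∧
      ∀ x y : F, x ≠ 0 → y ≠ 0 → c (x * y) = c x + c y := by
  choose! log hlog using hprim
  have hc (i : ℕ) : (log (α ^ i) : ZMod 3) = i := by
    have heq : Units.mk0 α hα ^ log (α ^ i) = Units.mk0 α hα ^ i :=
      Units.ext (by simpa using hlog _ (pow_ne_zero i hα))
    rw [pow_eq_pow_iff_modEq, ← orderOf_units, Units.val_mk0] at heq
    exact (ZMod.natCast_eq_natCast_iff _ _ 3).mpr (heq.of_dvd hdvd)
  refine ⟨fun x => log x, hc, fun x y hx hy => ?_⟩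
  have := hc (log x + log y)
  rwa [pow_add, hlog x hx, hlog y hy, Nat.cast_add] at this

theorem orderOf_primitive {F : Type*} [Field F] [Finite F] {α : F} (hα : α ≠ 0)
    (hprim : ∀ x : F, x ≠ 0 → ∃ i : ℕ, α ^ i = x) : orderOf α = Nat.card F - 1 := by
  rw [← Nat.card_units, ← orderOf_eq_card_of_forall_mem_zpowers (g := Units.mk0 α hα),
    ← orderOf_units, Units.val_mk0]
  intro x
  obtain ⟨i, hi⟩ := hprim x x.ne_zero
  exact ⟨i, Units.ext (by simpa using hi)⟩

theorem int_identity_of_sum_sq {q x y z : ℤ} (hsum : x + y + z = q + 1)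
    (hsq : 3 * (x ^ 2 + y ^ 2 + z ^ 2) = q ^ 2 + 4 * q + 1) :
    4 * q - (3 * (x + y) - 2 * (q + 1)) ^ 2 = 3 * ((x - y).natAbs : ℤ) ^ 2 := by
  rw [Int.natAbs_sq]
  obtain rfl : z = q + 1 - x - y := by linarith
  linear_combination -2 * hsq


/-- Singer model of `PG(2,q)` with `3 ∣ q²+q+1`, `t = 3`, `d = (q²+q+1)/3`, `ℓ0` any fixed
line, `w u = |ℓ0 ∩ O u|`.  Then for any two distinct `i, j ∈ {0,1,2}` there is a
nonnegative integer `s` with `4q − (3(w i + w j) − 2(q+1))² = 3 s²`. -/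
theorem stmt12
    (p h q v : ℕ) (hp : p.Prime) (hh : 1 ≤ h) (hq : q = p ^ h)
    (hv : v = q ^ 2 + q + 1)
    (F : Type) [Field F] [Fintype F] (hcard : Nat.card F = q ^ 3)
    (Fq : Subfield F) (hcardq : Nat.card Fq = q)
    (α : F) (hα : α ≠ 0) (hprim : ∀ x : F, x ≠ 0 → ∃ i : ℕ, α ^ i = x)
    (Pt : ℕ → Submodule Fq F) (hPt : ∀ i : ℕ, Pt i = Submodule.span Fq {α ^ i})
    (d t : ℕ) (hd : 0 < d) (hdt : v = d * t)
    (O : ℕ → Set (Submodule Fq F))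
    (hO : ∀ u : ℕ, O u = {P : Submodule Fq F | ∃ i : ℕ, i % t = u % t ∧ P = Pt i})
    (ℓ0 : Submodule Fq F) (hline : Module.finrank Fq ℓ0 = 2)
    (w : ℕ → ℕ)
    (hw : ∀ u : ℕ, w u = {P : Submodule Fq F | P ∈ O u ∧ P ≤ ℓ0}.ncard)
    (ht : t = 3) (h3 : 3 ∣ v)
    :
    ∀ i j : ℕ, i < 3 → j < 3 → i ≠ j →
      ∃ s : ℕ, 4 * (q : ℤ) - (3 * ((w i : ℤ) + (w j : ℤ)) - 2 * ((q : ℤ) + 1)) ^ 2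
        = 3 * (s : ℤ) ^ 2 := by
  have : Module.Finite Fq F := Module.Finite.of_finite
  have hq2 : 1 < q := hq ▸ Nat.one_lt_pow (by omega) hp.one_lt
  have hF : Module.finrank Fq F = 3 := by
    have := Module.natCard_eq_pow_finrank (K := Fq) (V := F)
    rw [hcard, hcardq] at this
    exact (Nat.pow_right_injective hq2 this).symm
  obtain ⟨m, rfl⟩ : ∃ m, q = m + 1 := ⟨q - 1, by omega⟩
  have hm0 : 0 < m := by omega
  have hord : orderOf α = m * v := by
    rw [orderOf_primitive hα hprim, hcard, hv]
    refine Nat.sub_eq_of_eq_add ?_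
    ring
  obtain ⟨c, hcα, hc⟩ := exists_classMap_primitive hα hprim (hord ▸ h3.mul_left m)
  have hcK (a : Fq) (ha : a ≠ 0) : c (algebraMap Fq F a) = 0 := by
    obtain ⟨i, hi⟩ := hprim (algebraMap Fq F a) ((map_ne_zero _).mpr ha)
    have : Fintype Fq := Fintype.ofFinite _
    have hpow := FiniteField.pow_card_sub_one_eq_one a ha
    rw [← Nat.card_eq_fintype_card, hcardq, Nat.add_sub_cancel] at hpow
    have hone : α ^ (m * i) = 1 := by
      rw [mul_comm, pow_mul, hi, ← map_pow, hpow, map_one]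
    have hdvd := orderOf_dvd_of_pow_eq_one hone
    rw [hord] at hdvd
    rw [← hi, hcα]
    exact (ZMod.natCast_eq_zero_iff i 3).mpr (h3.trans (Nat.dvd_of_mul_dvd_mul_left hm0 hdvd))
  have hN (u : ℕ) : (classVectors ℓ0 c u).card = m * w u := by
    rw [← mul_ncard_points_eq_card_classVectors hc hα hcα hprim hcK ℓ0 u hcardq, hw, hO, ht]
    simp only [hPt, Set.mem_ofPred_eq]
  have huniv (f : ZMod 3 → ℕ) : ∑ u, f u = f (0 : ℕ) + f (1 : ℕ) + f (2 : ℕ) :=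
    Fin.sum_univ_three f
  have hsum := sum_card_classVectors (c := c) ℓ0
  have hsq := three_mul_sum_card_classVectors_sq hc hα hcα hcK hF ℓ0 hline hcardq
  have hplane := card_filter_ne_zero_mem ℓ0
  rw [hline, hcardq, ← hsum] at hplane
  rw [huniv] at hplane hsq
  simp only [hN] at hplane hsq
  have hmz : (m : ℤ) ≠ 0 := by exact_mod_cast hm0.ne'
  have hsum' : (w 0 : ℤ) + w 1 + w 2 = ((m + 1 : ℕ) : ℤ) + 1 := by
    zify at hplane
    push_cast
    refine mul_left_cancel₀ hmz ?_
    linear_combination hplane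
  have hsq' : 3 * ((w 0 : ℤ) ^ 2 + w 1 ^ 2 + w 2 ^ 2) =
      ((m + 1 : ℕ) : ℤ) ^ 2 + 4 * ((m + 1 : ℕ) : ℤ) + 1 := by
    zify at hsq
    push_cast
    refine mul_left_cancel₀ (pow_ne_zero 2 hmz) ?_
    linear_combination hsq
  intro i j hi hj hij
  obtain ⟨k, hk, hk'⟩ : ∃ k, (w i : ℤ) + w j + w k = w 0 + w 1 + w 2 ∧
      (w i : ℤ) ^ 2 + w j ^ 2 + w k ^ 2 = w 0 ^ 2 + w 1 ^ 2 + w 2 ^ 2 := by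
    refine ⟨3 - i - j, ?_⟩
    interval_cases i <;> interval_cases j <;> first | omega | constructor <;> ring
  exact ⟨_, int_identity_of_sum_sq (hk.trans hsum') (by rw [hk', hsq'])⟩
end

section
/- In the Singer model of PG(2,q) with q = p^r (p prime) a square, let t be a prime divisor of q²+q+1 such that p mod t generates the multiplicative group of Z_t, let d = (q²+q+1)/t, and let ℓ_0 be a line invariant under τ : P_i ↦ P_{(ip) mod (q²+q+1)}, with w_u = |ℓ_0 ∩ O_u|. Then t divides q+√q+1 or t divides q−√q+1; in the first case w_1 = w_2 = … = w_{t−1} = (q+1+√q)/t and w_0 = (q+1+(1−t)√q)/t, and in the second case w_1 = w_2 = … = w_{t−1} = (q+1−√q)/t and w_0 = (q+1−(1−t)√q)/t. -/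
open Finset in
/-- The pairs of elements of `D` with difference in `S`, sorted by their difference. -/
theorem card_pairs_sub_mem {G : Type*} [AddCommGroup G] [DecidableEq G] (D S : Finset G) :
    #{x ∈ D ×ˢ D | x.2 - x.1 ∈ S} = ∑ k ∈ S, #{x ∈ D | x + k ∈ D} := by
  rw [card_eq_sum_card_fiberwise (f := fun x : G × G ↦ x.2 - x.1) (t := S)
    (s := {x ∈ D ×ˢ D | x.2 - x.1 ∈ S}) (fun x hx ↦ (mem_filter.1 hx).2)]
  refine sum_congr rfl fun k hk ↦ ?_
  refine card_nbij' (fun x ↦ x.1) (fun x ↦ (x, x + k)) ?_ ?_ ?_ ?_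
  · rintro ⟨x, y⟩ h
    simp only [coe_filter, mem_product, mem_filter, Set.mem_ofPred_eq] at h ⊢
    obtain ⟨⟨⟨hx, hy⟩, -⟩, rfl⟩ := h
    exact ⟨hx, by simpa using hy⟩
  · intro x h
    simp only [coe_filter, mem_product, mem_filter, Set.mem_ofPred_eq] at h ⊢
    simp [h, hk]
  · rintro ⟨x, y⟩ h
    simp only [coe_filter, mem_product, mem_filter, Set.mem_ofPred_eq] at h ⊢
    simp [← h.2]
  · intro x _
    rfl

open Finset in
/-- A set of size `q + 1` in a group of order `q ^ 2 + q + 1` in which every nonzero element is a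
difference is a planar difference set. -/
theorem card_difference_representations {G : Type*} [AddCommGroup G] [Fintype G] [DecidableEq G]
    {q : ℕ} {D : Finset G} (hD : #D = q + 1) (hG : Fintype.card G = q ^ 2 + q + 1)
    (hcover : ∀ k : G, k ≠ 0 → ∃ x ∈ D, x + k ∈ D) {k : G} (hk : k ≠ 0) :
    #{x ∈ D | x + k ∈ D} = 1 := by
  have hpos : ∀ k ∈ univ.erase (0 : G), 1 ≤ #{x ∈ D | x + k ∈ D} := fun k hk ↦ by
    obtain ⟨x, hx, hxk⟩ := hcover k (ne_of_mem_erase hk)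
    exact card_pos.2 ⟨x, mem_filter.2 ⟨hx, hxk⟩⟩
  have htotal := card_pairs_sub_mem D univ
  rw [← add_sum_erase _ _ (mem_univ (0 : G))] at htotal
  simp only [mem_univ, filter_true, card_product, hD, add_zero, filter_mem_eq_inter,
    inter_self] at htotal
  have hsum : ∑ k ∈ univ.erase (0 : G), 1 = ∑ k ∈ univ.erase (0 : G), #{x ∈ D | x + k ∈ D} := by
    rw [sum_const, card_erase_of_mem (mem_univ _), card_univ, hG, smul_eq_mul]
    simp only [add_tsub_cancel_right, mul_one]
    nlinarith
  exact ((sum_eq_sum_iff_of_le hpos).1 hsum k (mem_erase.2 ⟨hk, mem_univ _⟩)).symm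

open Finset in
/-- The second moment of the fibre sizes of a planar difference set under a homomorphism. -/
theorem sum_sq_card_fiber_s13 {G H : Type*} [AddCommGroup G] [Fintype G] [DecidableEq G]
    [AddCommGroup H] [Fintype H] [DecidableEq H] {q : ℕ} {D : Finset G} (hD : #D = q + 1)
    (hG : Fintype.card G = q ^ 2 + q + 1) (hcover : ∀ k : G, k ≠ 0 → ∃ x ∈ D, x + k ∈ D)
    (f : G →+ H) :
    ∑ z : H, #{x ∈ D | f x = z} ^ 2 = q + #{k : G | f k = 0} := by
  have hpairs : ∑ z : H, #{x ∈ D | f x = z} ^ 2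
      = #{x ∈ D ×ˢ D | x.2 - x.1 ∈ ({k : G | f k = 0} : Finset G)} := by
    rw [card_eq_sum_card_fiberwise (f := fun x : G × G ↦ f x.1) (t := univ) (fun _ _ ↦ by simp)]
    refine sum_congr rfl fun z _ ↦ ?_
    rw [sq, ← card_product]
    congr 1
    ext ⟨x, y⟩
    simp only [mem_product, mem_filter, mem_univ, true_and, map_sub, sub_eq_zero]
    grind
  have h0 : (0 : G) ∈ ({k : G | f k = 0} : Finset G) := by simp
  rw [hpairs, card_pairs_sub_mem, ← add_sum_erase _ _ h0,
    sum_congr rfl fun k hk ↦ card_difference_representations hD hG hcover (ne_of_mem_erase hk),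
    sum_const, card_erase_of_mem h0]
  have := card_pos.2 ⟨_, h0⟩
  simp only [add_zero, filter_mem_eq_inter, inter_self, hD, smul_eq_mul, mul_one]
  lia

/-- The elements of a finite subfield with `q` elements are the solutions of `x ^ q = x`. -/
theorem Subfield.mem_iff_pow_card_eq_self {F : Type*} [Field F] [Finite F] (K : Subfield F)
    (x : F) : x ∈ K ↔ x ^ Nat.card K = x := by
  classical
  have := Fintype.ofFinite F
  have := Fintype.ofFinite K
  set q := Nat.card K with hq
  have hq1 : 1 < q := Finite.one_lt_card
  have hpow : ∀ x ∈ K, x ^ q = x := fun x hx ↦ by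
    have := FiniteField.pow_card (⟨x, hx⟩ : K)
    rw [← Nat.card_eq_fintype_card] at this
    exact congrArg Subtype.val this
  refine ⟨hpow x, fun hx ↦ ?_⟩
  have hne : (Polynomial.X ^ q - Polynomial.X : Polynomial F) ≠ 0 :=
    FiniteField.X_pow_card_sub_X_ne_zero F hq1
  have hle : (Finset.univ.filter fun y : F ↦ y ^ q = y).card ≤ q := by
    refine (Polynomial.card_le_degree_of_subset_roots
      (p := Polynomial.X ^ q - Polynomial.X) fun y hy ↦ ?_).trans
      (FiniteField.X_pow_card_sub_X_natDegree_eq F hq1).le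
    rw [Finset.mem_val, Finset.mem_filter] at hy
    simp [hne, hy.2]
  have heq : (Finset.univ.filter fun y : F ↦ y ∈ K) = Finset.univ.filter fun y : F ↦ y ^ q = y := by
    refine Finset.eq_of_subset_of_card_le (fun y hy ↦ ?_) (hle.trans ?_)
    · simpa using hpow y (by simpa using hy)
    · rw [← Fintype.card_subtype, hq, Nat.card_eq_fintype_card]
  have : x ∈ Finset.univ.filter fun y : F ↦ y ∈ K := by rw [heq]; simpa using hx
  simpa using this

/-- The multiplicative group of a subfield with `q` elements of a field with `q ^ 3` elements is
generated by the `(q ^ 2 + q + 1)`-th power of a primitive element. -/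
theorem Subfield.primitive_pow_mem_iff {F : Type*} [Field F] [Finite F] {q : ℕ}
    (hcard : Nat.card F = q ^ 3) (K : Subfield F) (hK : Nat.card K = q) {α : F} (hα : α ≠ 0)
    (hprim : ∀ x : F, x ≠ 0 → ∃ i : ℕ, α ^ i = x) (n : ℕ) :
    α ^ n ∈ K ↔ q ^ 2 + q + 1 ∣ n := by
  have hq1 : 1 < q := hK ▸ Finite.one_lt_card
  obtain ⟨s, rfl⟩ : ∃ s, q = s + 1 := ⟨q - 1, by lia⟩
  have hord : orderOf α = ((s + 1) ^ 2 + (s + 1) + 1) * s := by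
    have h := orderOf_eq_card_of_forall_mem_zpowers (g := Units.mk0 α hα) fun x ↦ by
      obtain ⟨i, hi⟩ := hprim x x.ne_zero
      exact ⟨i, by ext; simpa using hi⟩
    rw [← orderOf_units, Units.val_mk0, Nat.card_units, hcard] at h
    rw [h, Nat.sub_eq_iff_eq_add (Nat.one_le_pow _ _ (by lia))]
    ring
  rw [K.mem_iff_pow_card_eq_self, hK, ← pow_mul, mul_add, pow_add, mul_one,
    mul_eq_right₀ (pow_ne_zero _ hα), ← orderOf_dvd_iff_pow_eq_one, hord]
  exact Nat.mul_dvd_mul_iff_right (by lia)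

/-- The fibre sizes of a planar difference set of order `q = m ^ 2` over a group of order `t` are
determined by their first two moments up to the sign of `m`, if the `t - 1` fibres over the nonzero
elements all have the same size `b`. -/
theorem fiber_cards_of_const {q d t m a b : ℤ} (ht : 1 < t) (hq : q = m ^ 2)
    (hdt : q ^ 2 + q + 1 = d * t) (hsum : a + (t - 1) * b = q + 1)
    (hsq : a ^ 2 + (t - 1) * b ^ 2 = q + d) :
    (t * b = q + 1 - m ∧ t * a = q + 1 - (1 - t) * m) ∨
      (t * b = q + 1 + m ∧ t * a = q + 1 + (1 - t) * m) := by
  have h : (t - 1) * ((a - b) ^ 2 - m ^ 2) = 0 := by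
    linear_combination t * hsq - (a + (t - 1) * b + q + 1) * hsum - hdt + (t - 1) * hq
  have h' : (a - b - m) * (a - b + m) = 0 := by
    rcases mul_eq_zero.1 h with h | h
    · lia
    · linear_combination h
  rcases mul_eq_zero.1 h' with h | h
  · left
    constructor
    · linear_combination hsum - h
    · linear_combination hsum + (t - 1) * h
  · right
    constructor
    · linear_combination hsum - h
    · linear_combination hsum + (t - 1) * h

section Singer

variable {F : Type*} [Field F] {q : ℕ} {K : Subfield F} {α : F}

open scoped Classical in
/-- The exponents, modulo `q ^ 2 + q + 1`, of the points of a subspace in the Singer model. -/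
noncomputable def singerSet (q : ℕ) (α : F) (ℓ : Submodule K F) :
    Finset (ZMod (q ^ 2 + q + 1)) :=
  {x | α ^ x.val ∈ ℓ}

theorem mem_singerSet {ℓ : Submodule K F} {x : ZMod (q ^ 2 + q + 1)} :
    x ∈ singerSet q α ℓ ↔ α ^ x.val ∈ ℓ := by
  simp [singerSet]

variable [Finite F]

/-- The points `⟨α ^ i⟩` and `⟨α ^ j⟩` of `PG(2, q)` agree iff `i` and `j` agree modulo
`q ^ 2 + q + 1`. -/
theorem span_primitive_pow_eq_iff (hcard : Nat.card F = q ^ 3) (hK : Nat.card K = q) (hα : α ≠ 0)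
    (hprim : ∀ x : F, x ≠ 0 → ∃ i : ℕ, α ^ i = x) (i j : ℕ) :
    Submodule.span K {α ^ i} = Submodule.span K {α ^ j} ↔
      (i : ZMod (q ^ 2 + q + 1)) = (j : ZMod (q ^ 2 + q + 1)) := by
  wlog hij : i ≤ j generalizing i j
  · rw [eq_comm, this j i (by lia), eq_comm]
  rw [Submodule.span_singleton_eq_span_singleton, ZMod.natCast_eq_natCast_iff,
    Nat.modEq_iff_dvd' hij, ← K.primitive_pow_mem_iff hcard hK hα hprim]
  obtain ⟨k, rfl⟩ := Nat.exists_eq_add_of_le hij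
  rw [Nat.add_sub_cancel_left, pow_add]
  constructor
  · rintro ⟨z, hz⟩
    have : (z : K) = α ^ k := by
      refine mul_left_cancel₀ (pow_ne_zero i hα) ?_
      rw [← hz, mul_comm]
      rfl
    exact this ▸ (z : K).2
  · intro hk
    refine ⟨Units.mk0 ⟨α ^ k, hk⟩ fun h ↦ pow_ne_zero k hα (congrArg Subtype.val h), ?_⟩
    exact mul_comm _ _

theorem primitive_pow_mem_iff_of_natCast_eq (hcard : Nat.card F = q ^ 3) (hK : Nat.card K = q)
    (hα : α ≠ 0) (hprim : ∀ x : F, x ≠ 0 → ∃ i : ℕ, α ^ i = x) (ℓ : Submodule K F) {i j : ℕ}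
    (hij : (i : ZMod (q ^ 2 + q + 1)) = (j : ZMod (q ^ 2 + q + 1))) :
    α ^ i ∈ ℓ ↔ α ^ j ∈ ℓ := by
  rw [← Submodule.span_singleton_le_iff_mem, ← Submodule.span_singleton_le_iff_mem,
    (span_primitive_pow_eq_iff hcard hK hα hprim i j).2 hij]

theorem natCast_mem_singerSet (hcard : Nat.card F = q ^ 3) (hK : Nat.card K = q) (hα : α ≠ 0)
    (hprim : ∀ x : F, x ≠ 0 → ∃ i : ℕ, α ^ i = x) {ℓ : Submodule K F} (n : ℕ) :
    (n : ZMod (q ^ 2 + q + 1)) ∈ singerSet q α ℓ ↔ α ^ n ∈ ℓ := by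
  rw [mem_singerSet]
  exact primitive_pow_mem_iff_of_natCast_eq hcard hK hα hprim ℓ (ZMod.natCast_zmod_val _)

open Finset in
theorem card_singerSet (hcard : Nat.card F = q ^ 3) (hK : Nat.card K = q) (hα : α ≠ 0)
    (hprim : ∀ x : F, x ≠ 0 → ∃ i : ℕ, α ^ i = x) {ℓ : Submodule K F}
    (hℓ : Module.finrank K ℓ = 2) :
    #(singerSet q α ℓ) = q + 1 := by
  classical
  have := Fintype.ofFinite F
  have := Fintype.ofFinite K
  have hq1 : 1 < q := hK ▸ Finite.one_lt_card
  have hbij : #((univ.erase (0 : K)) ×ˢ singerSet q α ℓ)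
      = #((univ.filter fun y : F ↦ y ∈ ℓ).erase 0) := by
    refine card_bij (fun x _ ↦ (x.1 : F) * α ^ x.2.val) ?_ ?_ ?_
    · rintro ⟨c, x⟩ h
      simp only [mem_product, mem_erase, mem_univ, and_true, mem_singerSet] at h
      simp only [mem_erase, mem_filter, mem_univ, true_and]
      exact ⟨mul_ne_zero (by simpa using h.1) (pow_ne_zero _ hα), ℓ.smul_mem c h.2⟩
    · rintro ⟨c, x⟩ hc ⟨c', x'⟩ hc' h
      simp only [mem_product, mem_erase, mem_univ, and_true] at hc hc' h
      have hspan : ∀ (c : K) (n : ℕ), c ≠ 0 →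
          Submodule.span K {(c : F) * α ^ n} = Submodule.span K {α ^ n} := fun c n hc ↦
        Submodule.span_singleton_smul_eq (IsUnit.mk0 c hc) (α ^ n)
      have hx : x = x' := by
        have := hspan c' x'.val hc'.1
        rw [← h, hspan c x.val hc.1, span_primitive_pow_eq_iff hcard hK hα hprim] at this
        simpa using this
      subst hx
      simpa using mul_right_cancel₀ (pow_ne_zero _ hα) h
    · intro y hy
      simp only [mem_erase, mem_filter, mem_univ, true_and] at hy
      obtain ⟨n, rfl⟩ := hprim y hy.1
      have hspan := (span_primitive_pow_eq_iff hcard hK hα hprim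
        (n : ZMod (q ^ 2 + q + 1)).val n).2 (by simp)
      obtain ⟨z, hz⟩ := Submodule.span_singleton_eq_span_singleton.1 hspan
      refine ⟨⟨z, n⟩, ?_, hz⟩
      simp [natCast_mem_singerSet hcard hK hα hprim, hy.2]
  have hℓcard : #(univ.filter fun y : F ↦ y ∈ ℓ) = q ^ 2 := by
    rw [← Fintype.card_subtype, ← Nat.card_eq_fintype_card, ← hK, ← hℓ]
    exact Module.natCard_eq_pow_finrank (K := K) (V := ℓ)
  rw [card_product, card_erase_of_mem (mem_univ _), card_univ, ← Nat.card_eq_fintype_card, hK,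
    card_erase_of_mem (by simp), hℓcard] at hbij
  refine Nat.eq_of_mul_eq_mul_left (by lia : 0 < q - 1) (hbij.trans ?_)
  obtain ⟨s, rfl⟩ : ∃ s, q = s + 1 := ⟨q - 1, by lia⟩
  rw [Nat.sub_eq_iff_eq_add (Nat.one_le_pow _ _ (by lia)), Nat.add_sub_cancel]
  ring

/-- Any two lines of `PG(2, q)` meet: every residue is a difference of exponents of points of a
given line. -/
theorem exists_add_mem_singerSet (hcard : Nat.card F = q ^ 3) (hK : Nat.card K = q) (hα : α ≠ 0)
    (hprim : ∀ x : F, x ≠ 0 → ∃ i : ℕ, α ^ i = x) {ℓ : Submodule K F}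
    (hℓ : Module.finrank K ℓ = 2) (k : ZMod (q ^ 2 + q + 1)) :
    ∃ x ∈ singerSet q α ℓ, x + k ∈ singerSet q α ℓ := by
  have hq1 : 1 < q := hK ▸ Finite.one_lt_card
  have hF : Module.finrank K F = 3 := by
    have := Module.natCard_eq_pow_finrank (K := K) (V := F)
    rw [hcard, hK] at this
    exact (Nat.pow_right_injective hq1 this).symm
  let e : F ≃ₗ[K] F :=
    (LinearEquiv.smulOfNeZero F F (α ^ k.val) (pow_ne_zero _ hα)).restrictScalars K
  let ℓ' : Submodule K F := ℓ.comap (e : F →ₗ[K] F)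
  have hℓ' : Module.finrank K ℓ' = 2 := by
    rw [← hℓ]
    exact LinearEquiv.finrank_eq (e.ofSubmodule' ℓ)
  have hpos : 0 < Module.finrank K ↥(ℓ ⊓ ℓ') := by
    have h1 := Submodule.finrank_sup_add_finrank_inf_eq ℓ ℓ'
    have h2 := Submodule.finrank_le (ℓ ⊔ ℓ')
    lia
  have hne : ℓ ⊓ ℓ' ≠ ⊥ := fun h ↦ by
    rw [h, finrank_bot] at hpos
    exact hpos.false
  obtain ⟨y, ⟨hy, hy'⟩, hy0⟩ := Submodule.exists_mem_ne_zero_of_ne_bot hne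
  obtain ⟨n, rfl⟩ := hprim y hy0
  refine ⟨n, (natCast_mem_singerSet hcard hK hα hprim n).2 hy, ?_⟩
  have : (n : ZMod (q ^ 2 + q + 1)) + k = ((k.val + n : ℕ) : ZMod (q ^ 2 + q + 1)) := by
    simp [add_comm]
  rw [this, natCast_mem_singerSet hcard hK hα hprim, pow_add]
  exact hy'

end Singer

/-- Singer model of `PG(2,q)` with `q = p^r` a perfect square, `t` a prime divisor of
`v = q²+q+1` such that `p mod t` generates the multiplicative group of `Z_t`,
`d = v/t`, `ℓ0` a line invariant under `τ : P_i ↦ P_{(i·p) mod v}`, `w u = |ℓ0 ∩ O u|`.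
Then `t` divides `q+√q+1` or `q−√q+1`; in the first case
`w 1 = … = w (t-1) = (q+1+√q)/t` and `w 0 = (q+1+(1−t)√q)/t`, in the second case
`w 1 = … = w (t-1) = (q+1−√q)/t` and `w 0 = (q+1−(1−t)√q)/t` (stated in `ℤ`,
multiplied through by `t`, with `√q` the integer square root). -/
theorem stmt13
    (p h q v : ℕ) (hp : p.Prime) (hh : 1 ≤ h) (hq : q = p ^ h)
    (hv : v = q ^ 2 + q + 1)
    (F : Type) [Field F] [Fintype F] (hcard : Nat.card F = q ^ 3)
    (Fq : Subfield F) (hcardq : Nat.card Fq = q)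
    (α : F) (hα : α ≠ 0) (hprim : ∀ x : F, x ≠ 0 → ∃ i : ℕ, α ^ i = x)
    (Pt : ℕ → Submodule Fq F) (hPt : ∀ i : ℕ, Pt i = Submodule.span Fq {α ^ i})
    (d t : ℕ) (hd : 0 < d) (hdt : v = d * t)
    (O : ℕ → Set (Submodule Fq F))
    (hO : ∀ u : ℕ, O u = {P : Submodule Fq F | ∃ i : ℕ, i % t = u % t ∧ P = Pt i})
    (ℓ0 : Submodule Fq F) (hline : Module.finrank Fq ℓ0 = 2)
    (w : ℕ → ℕ)
    (hw : ∀ u : ℕ, w u = {P : Submodule Fq F | P ∈ O u ∧ P ≤ ℓ0}.ncard)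
    (hinv : ∀ i : ℕ, α ^ i ∈ ℓ0 ↔ α ^ ((i * p) % v) ∈ ℓ0)
    (hsq : ∃ m : ℕ, q = m ^ 2)
    (ht : t.Prime) (hgen : ∀ x : ZMod t, x ≠ 0 → ∃ n : ℕ, x = (p : ZMod t) ^ n)
    :
    (((t : ℤ) ∣ (q : ℤ) + Nat.sqrt q + 1 ∨ (t : ℤ) ∣ (q : ℤ) - Nat.sqrt q + 1)) ∧
    ((t : ℤ) ∣ (q : ℤ) + Nat.sqrt q + 1 →
      (∀ u : ℕ, 1 ≤ u → u ≤ t - 1 → (t : ℤ) * w u = (q : ℤ) + 1 + Nat.sqrt q) ∧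
      (t : ℤ) * w 0 = (q : ℤ) + 1 + (1 - (t : ℤ)) * Nat.sqrt q) ∧
    ((t : ℤ) ∣ (q : ℤ) - Nat.sqrt q + 1 →
      (∀ u : ℕ, 1 ≤ u → u ≤ t - 1 → (t : ℤ) * w u = (q : ℤ) + 1 - Nat.sqrt q) ∧
      (t : ℤ) * w 0 = (q : ℤ) + 1 - (1 - (t : ℤ)) * Nat.sqrt q) := by
  classical
  subst hv
  obtain ⟨m, hm⟩ := hsq
  have hsqrt : Nat.sqrt q = m := by rw [hm, Nat.sqrt_eq']
  have : Fact t.Prime := ⟨ht⟩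
  have htv : t ∣ q ^ 2 + q + 1 := ⟨d, by rw [hdt, mul_comm]⟩
  have hpv : p.Coprime (q ^ 2 + q + 1) := by
    rw [hp.coprime_iff_not_dvd]
    intro h
    have hpq : p ∣ q := hq ▸ dvd_pow_self p (by lia)
    rw [Nat.dvd_add_right (dvd_add (dvd_pow hpq two_ne_zero) hpq)] at h
    exact hp.one_lt.ne' (Nat.dvd_one.1 h)
  let f := ZMod.castHom htv (ZMod t)
  have hfval : ∀ x : ZMod (q ^ 2 + q + 1), f x = (x.val : ZMod t) := fun x ↦ by
    conv_lhs => rw [← ZMod.natCast_zmod_val x]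
    exact map_natCast f _
  let D := singerSet q α ℓ0
  have hDcard : D.card = q + 1 := card_singerSet hcard hcardq hα hprim hline
  let N : ZMod t → ℕ := fun z ↦ (D.filter fun x ↦ f x = z).card
  have hwN : ∀ u : ℕ, w u = N u := fun u ↦ by
    rw [hw, show N u = (D.filter fun x ↦ f x = u).card from rfl, ← Set.ncard_coe_finset,
      ← Set.InjOn.ncard_image (f := fun x : ZMod (q ^ 2 + q + 1) ↦ Pt x.val)]
    · congr 1
      ext P
      simp only [hO, Set.mem_ofPred_eq, Set.mem_image, Finset.coe_filter]
      constructor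
      · rintro ⟨⟨i, hi, rfl⟩, hP⟩
        rw [hPt, Submodule.span_singleton_le_iff_mem] at hP
        refine ⟨i, ⟨(natCast_mem_singerSet hcard hcardq hα hprim i).2 hP, ?_⟩, ?_⟩
        · rw [map_natCast, ZMod.natCast_eq_natCast_iff']
          exact hi
        · rw [hPt, hPt, span_primitive_pow_eq_iff hcard hcardq hα hprim]
          simp
      · rintro ⟨x, ⟨hx, hfx⟩, rfl⟩
        refine ⟨⟨x.val, ?_, rfl⟩, ?_⟩
        · rwa [hfval, ZMod.natCast_eq_natCast_iff'] at hfx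
        · rw [hPt, Submodule.span_singleton_le_iff_mem]
          exact mem_singerSet.1 hx
    · intro x _ y _ hxy
      simpa [hPt, span_primitive_pow_eq_iff hcard hcardq hα hprim] using hxy
  have hDp : ∀ x : ZMod (q ^ 2 + q + 1), x * (p : ZMod (q ^ 2 + q + 1)) ∈ D ↔ x ∈ D := fun x ↦ by
    have h1 : x * (p : ZMod (q ^ 2 + q + 1)) = ((x.val * p : ℕ) : ZMod (q ^ 2 + q + 1)) := by simp
    rw [mem_singerSet, mem_singerSet, hinv x.val, h1, ZMod.val_natCast]
  have hpt : (p : ZMod t) ≠ 0 := by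
    rw [Ne, ZMod.natCast_eq_zero_iff]
    intro h
    rw [Nat.prime_dvd_prime_iff_eq ht hp] at h
    exact ht.one_lt.ne' (Nat.Coprime.eq_one_of_dvd (h ▸ hpv) htv)
  have hNp : ∀ z, N (z * p) = N z := fun z ↦ by
    symm
    refine Finset.card_bijective (fun x ↦ x * (p : ZMod (q ^ 2 + q + 1)))
      (ZMod.unitOfCoprime p hpv).mulRight_bijective fun x ↦ ?_
    simp only [Finset.mem_filter, hDp, map_mul, map_natCast, mul_left_inj' hpt]
  have hNpow : ∀ n : ℕ, N ((p : ZMod t) ^ n) = N 1 := fun n ↦ by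
    induction n with
    | zero => rw [pow_zero]
    | succ n ih => rw [pow_succ, hNp, ih]
  have hNne : ∀ z : ZMod t, z ≠ 0 → N z = N 1 := fun z hz ↦ by
    obtain ⟨n, rfl⟩ := hgen z hz
    exact hNpow n
  have hsplit : ∀ g : ℕ → ℕ, ∑ z : ZMod t, g (N z) = g (N 0) + (t - 1) * g (N 1) := fun g ↦ by
    rw [← Finset.add_sum_erase _ _ (Finset.mem_univ 0),
      Finset.sum_congr rfl fun z hz ↦ congrArg g (hNne z (Finset.ne_of_mem_erase hz)),
      Finset.sum_const, Finset.card_erase_of_mem (Finset.mem_univ _), Finset.card_univ,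
      ZMod.card, smul_eq_mul]
  have hker : (Finset.univ.filter fun k ↦ f k = 0).card = d := by
    have hfib : ∀ z : ZMod t, (Finset.univ.filter fun k ↦ f k = z).card
        = (Finset.univ.filter fun k ↦ f k = 0).card := fun z ↦
      AddMonoidHom.card_fiber_eq_of_mem_range f (ZMod.castHom_surjective htv z)
        (ZMod.castHom_surjective htv 0)
    have h := Finset.card_eq_sum_card_fiberwise (f := f) (s := Finset.univ) (t := Finset.univ)
      (fun _ _ ↦ by simp)
    rw [Finset.sum_congr rfl fun z _ ↦ hfib z, Finset.sum_const, Finset.card_univ,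
      Finset.card_univ, ZMod.card, ZMod.card, smul_eq_mul] at h
    exact Nat.eq_of_mul_eq_mul_left ht.pos (h.symm.trans (hdt.trans (mul_comm d t)))
  have hsum : N 0 + (t - 1) * N 1 = q + 1 := by
    rw [← hsplit fun x ↦ x, ← hDcard]
    exact (Finset.card_eq_sum_card_fiberwise (fun _ _ ↦ by simp)).symm
  have hsumsq : N 0 ^ 2 + (t - 1) * N 1 ^ 2 = q + d := by
    rw [← hsplit fun x ↦ x ^ 2, ← hker]
    exact sum_sq_card_fiber_s13 hDcard (ZMod.card (q ^ 2 + q + 1))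
      (fun k _ ↦ exists_add_mem_singerSet hcard hcardq hα hprim hline k) f.toAddMonoidHom
  have hw0 : w 0 = N 0 := by rw [hwN, Nat.cast_zero]
  have hwu : ∀ u : ℕ, 1 ≤ u → u ≤ t - 1 → w u = N 1 := fun u h1 h2 ↦ by
    rw [hwN]
    refine hNne _ fun h ↦ ?_
    rw [ZMod.natCast_eq_zero_iff] at h
    have := Nat.le_of_dvd h1 h
    have := ht.pos
    lia
  have ht1 := ht.one_lt
  zify [ht1.le] at hsum hsumsq hdt hm ht1
  have hfac : (t : ℤ) ∣ (q + m + 1) * (q - m + 1) :=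
    ⟨d, by linear_combination hdt + hm⟩
  have hnot : (t : ℤ) ∣ q + m + 1 → ¬ (t : ℤ) ∣ q - m + 1 := fun h1 h2 ↦ by
    have hprime := Nat.prime_iff_prime_int.1 ht
    have hm2 : (t : ℤ) ∣ 2 * m := by
      have := dvd_sub h1 h2
      ring_nf at this ⊢
      exact this
    have hodd : ¬ (t : ℤ) ∣ 2 := fun h ↦ by
      have h2t : t = 2 := (Nat.prime_dvd_prime_iff_eq ht Nat.prime_two).1 (by exact_mod_cast h)
      have : ¬ 2 ∣ q ^ 2 + q + 1 := by
        have := Nat.even_mul_succ_self q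
        rw [← even_iff_two_dvd, Nat.not_even_iff_odd]
        convert this.add_one using 1
        ring
      exact this (h2t ▸ htv)
    have hmt : (t : ℤ) ∣ m := (hprime.dvd_or_dvd hm2).resolve_left hodd
    have hq' : (t : ℤ) ∣ q := hm ▸ dvd_pow hmt two_ne_zero
    have h3 : (t : ℤ) ∣ 1 := (dvd_add_right (dvd_add hq' hmt)).1 h1
    exact hprime.not_dvd_one h3
  rw [hsqrt]
  refine ⟨(Nat.prime_iff_prime_int.1 ht).dvd_or_dvd hfac, fun h ↦ ?_, fun h ↦ ?_⟩
  all_goals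
    rcases fiber_cards_of_const ht1 hm hdt hsum hsumsq with ⟨hb, ha⟩ | ⟨hb, ha⟩
  · exact absurd ⟨N 1, by linear_combination -hb⟩ (hnot h)
  · exact ⟨fun u h1 h2 ↦ by rw [hwu u h1 h2, hb], by rw [hw0, ha]⟩
  · exact ⟨fun u h1 h2 ↦ by rw [hwu u h1 h2, hb], by rw [hw0, ha]⟩
  · exact absurd h (hnot ⟨N 1, by linear_combination -hb⟩)
end
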